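/- arXiv:2206.10752 — 3 statements merged into one kernel-verified Lean document; each statement's English description precedes it below -/
import Mathlib

section
/- Let G be a finite nonabelian group that is minimally faithful of degree 3, and suppose the commutator subgroup [G,G] has odd order. Then one of the following holds: (i) G has odd order; (ii) there exist distinct odd primes p, q and m ≥ 1 such that G is isomorphic to (C_q ⋊ C_{2^m}) × C_p × C_p, where a generator of C_{2^m} acts on C_q by inversion; (iii) there exist an odd prime p and m ≥ 2 such that G is isomorphic to (C_p ⋊ C_{2^m}) × C_2, where a generator of C_{2^m} acts on C_p by inversion. -/
/-- `rdim G` is the smallest `n` such that `G` has a faithful `n`-dimensional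
complex representation, i.e. an injective group homomorphism `G →* GL n ℂ`. -/
noncomputable def rdim (G : Type*) [Group G] : ℕ :=
  sInf {n : ℕ | ∃ ρ : G →* GL (Fin n) ℂ, Function.Injective ρ}

/-- `G` is minimally faithful of degree `n` if `rdim G = n` and every proper
subgroup has strictly smaller representation dimension. -/
def MinFaithful (G : Type*) [Group G] (n : ℕ) : Prop :=
  rdim G = n ∧ ∀ H : Subgroup G, H ≠ ⊤ → rdim H < n

open Matrix in
theorem cent_comm (A B C : Matrix (Fin 2) (Fin 2) ℂ) (hA : ¬ ∃ c : ℂ, A = c • 1)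
    (hB : A * B = B * A) (hC : A * C = C * A) : B * C = C * B := by
  have hB00 := congrFun (congrFun hB 0) 0
  have hB01 := congrFun (congrFun hB 0) 1
  have hB10 := congrFun (congrFun hB 1) 0
  have hC00 := congrFun (congrFun hC 0) 0
  have hC01 := congrFun (congrFun hC 0) 1
  have hC10 := congrFun (congrFun hC 1) 0
  simp only [Matrix.mul_apply, Fin.sum_univ_two] at hB00 hB01 hB10 hC00 hC01 hC10
  have hns : A 0 1 ≠ 0 ∨ A 1 0 ≠ 0 ∨ A 0 0 - A 1 1 ≠ 0 := by
    by_contra hcon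
    push Not at hcon
    obtain ⟨h1, h2, h3⟩ := hcon
    apply hA
    refine ⟨A 0 0, ?_⟩
    ext i j
    fin_cases i <;> fin_cases j <;> simp [h1, h2]
    linear_combination -h3
  generalize A 0 0 = a at *
  generalize A 0 1 = b at *
  generalize A 1 0 = c at *
  generalize A 1 1 = d at *
  have key : ∀ t : ℂ, (b ≠ 0 → b * t = 0) → (c ≠ 0 → c * t = 0) →
      (a - d ≠ 0 → (a - d) * t = 0) → t = 0 := by
    intro t h1 h2 h3
    rcases hns with h | h | h
    · exact (mul_eq_zero.mp (h1 h)).resolve_left h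
    · exact (mul_eq_zero.mp (h2 h)).resolve_left h
    · exact (mul_eq_zero.mp (h3 h)).resolve_left h
  have e1 : B 0 1 * C 1 0 - C 0 1 * B 1 0 = 0 := by
    apply key <;> intro h
    · linear_combination B 0 1 * hC00 - C 0 1 * hB00
    · linear_combination B 1 0 * hC00 - C 1 0 * hB00
    · grind
  have e2 : (B 0 0 - B 1 1) * C 0 1 - (C 0 0 - C 1 1) * B 0 1 = 0 := by
    apply key <;> intro h
    · linear_combination B 0 1 * hC01 - C 0 1 * hB01
    · grind
    · grind
  have e3 : (B 0 0 - B 1 1) * C 1 0 - (C 0 0 - C 1 1) * B 1 0 = 0 := by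
    apply key <;> intro h
    · grind
    · grind
    · grind
  ext i j
  fin_cases i <;> fin_cases j <;> simp only [Matrix.mul_apply, Fin.sum_univ_two, Fin.zero_eta, Fin.mk_one]
  · linear_combination e1
  · linear_combination e2
  · linear_combination -e3
  · linear_combination -e1

theorem unip {R : Type*} [Ring R] [Algebra ℂ R] (x : R) (n : ℕ) (hn : n ≠ 0)
    (h : (x - 1) * (x - 1) = 0) (hx : x ^ n = 1) : x = 1 := by
  have key : ∀ k : ℕ, x ^ k = 1 + (k : ℂ) • (x - 1) := by
    intro k
    induction k with
    | zero => simp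
    | succ k ih =>
      have : x * (x - 1) = x - 1 := by
        have : x * (x - 1) = (x - 1) * (x - 1) + (x - 1) := by noncomm_ring
        rw [this, h, zero_add]
      rw [pow_succ', ih, mul_add, mul_smul_comm, this, mul_one]
      push_cast
      rw [add_smul, one_smul]
      abel
  have h1 := key n
  rw [hx] at h1
  have h2 : (n : ℂ) • (x - 1) = 0 := by simpa using h1.symm
  have h3 : x - 1 = 0 := by
    have := congrArg (fun y => (n : ℂ)⁻¹ • y) h2
    simpa [smul_smul, hn] using this
  exact sub_eq_zero.mp h3

theorem trace_int {n : ℕ} (A : Matrix (Fin n) (Fin n) ℂ) (k : ℕ) (hk : k ≠ 0) (h : A ^ k = 1) :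
    IsIntegral ℤ A.trace := by
  rw [Matrix.trace_eq_sum_roots_charpoly]
  apply IsIntegral.multiset_sum
  intro r hr
  have h1 : r ∈ spectrum ℂ A := by
    rw [Matrix.mem_spectrum_iff_isRoot_charpoly]
    exact (Polynomial.mem_roots'.mp hr).2
  have h2 := spectrum.pow_mem_pow A k h1
  rw [h] at h2
  rcases isEmpty_or_nonempty (Fin n) with he | he
  · exfalso
    rw [spectrum.mem_iff] at h1
    exact h1 (by rw [Subsingleton.elim (algebraMap ℂ _ r - A) 1]; exact isUnit_one)
  rw [spectrum.one_eq] at h2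
  refine IsIntegral.of_pow (Nat.pos_of_ne_zero hk) ?_
  rw [Set.mem_singleton_iff.mp h2]
  exact isIntegral_one

theorem half_not_int (z : ℂ) (hz : IsIntegral ℤ z) (n : ℕ) (hn : Odd n) (h : (n : ℂ) = 2 * z) : False := by
  obtain ⟨m, rfl⟩ := hn
  have h1 : z = algebraMap ℚ ℂ (m + 1/2) := by
    push_cast at h
    simp
    linear_combination -h/2
  rw [h1, isIntegral_algebraMap_iff (algebraMap ℚ ℂ).injective] at hz
  obtain ⟨y, hy⟩ := IsIntegrallyClosed.isIntegral_iff.mp hz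
  simp at hy
  have : (2 * y : ℚ) = 2 * m + 1 := by rw [hy]; ring
  have : 2 * y = 2 * m + 1 := by exact_mod_cast this
  omega

theorem odd_sum_inv {H : Type*} [Group H] [Fintype H] (hodd : Odd (Nat.card H)) (f : H → ℂ)
    (hf : ∀ g, f g⁻¹ = f g) (hIntg : ∀ g, IsIntegral ℤ (f g)) :
    ∃ z : ℂ, IsIntegral ℤ z ∧ ∑ g, f g = f 1 + 2 * z := by
  classical
  let R := integralClosure ℤ ℂ
  let F : H → R := fun g => ⟨f g, hIntg g⟩
  have h22 : ((2 : R) : ℂ) = 2 := rfl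
  have hs : ∑ g ∈ Finset.univ.erase (1 : H), Ideal.Quotient.mk (Ideal.span {(2 : R)}) (F g) = 0 := by
    refine Finset.sum_involution (fun g _ => g⁻¹) ?_ ?_ ?_ ?_
    · intro a ha
      rw [← map_add, Ideal.Quotient.eq_zero_iff_mem, Ideal.mem_span_singleton]
      refine ⟨F a, ?_⟩
      apply Subtype.ext
      simp [F, hf, h22]
      ring
    · intro a ha _ h
      have h1 : a ≠ 1 := by simpa using ha
      have h2 : a ^ 2 = 1 := by
        rw [pow_two]; nth_rewrite 1 [← h]; simp
      have h3 : orderOf a = 2 := orderOf_eq_prime h2 h1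
      have h4 : 2 ∣ Nat.card H := h3 ▸ orderOf_dvd_natCard a
      exact (Nat.not_even_iff_odd.mpr hodd) (even_iff_two_dvd.mpr h4)
    · intro a ha; simpa using ha
    · intro a ha; simp
  rw [← map_sum, Ideal.Quotient.eq_zero_iff_mem, Ideal.mem_span_singleton] at hs
  obtain ⟨z, hz⟩ := hs
  refine ⟨z, z.2, ?_⟩
  have h2 := congrArg (Subtype.val) hz
  rw [← Finset.add_sum_erase _ f (Finset.mem_univ 1)]
  congr 1
  simpa [F, h22] using h2

theorem odd_comm {H : Type*} [Group H] [Finite H] (hodd : Odd (Nat.card H))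
    (β : H →* Matrix (Fin 2) (Fin 2) ℂ) (a b : H) : β a * β b = β b * β a := by
  classical
  have := Fintype.ofFinite H
  by_cases hsc : ∃ A : Matrix (Fin 2) (Fin 2) ℂ, (¬ ∃ c : ℂ, A = c • 1) ∧ ∀ g, A * β g = β g * A
  · obtain ⟨A, hA, hc⟩ := hsc
    exact cent_comm A _ _ hA (hc a) (hc b)
  exfalso
  push Not at hsc
  have havg : ∀ X : Matrix (Fin 2) (Fin 2) ℂ, ∃ c : ℂ, ∑ g, β g * X * β g⁻¹ = c • 1 := by
    intro X
    by_contra hcon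
    obtain ⟨h, hh⟩ := hsc (∑ g, β g * X * β g⁻¹) (by simpa using hcon)
    apply hh
    rw [Finset.sum_mul, Finset.mul_sum]
    refine Fintype.sum_equiv (Equiv.mulLeft h⁻¹) _ _ ?_
    intro g
    simp only [Equiv.coe_mulLeft, map_mul, mul_inv_rev, inv_inv, mul_assoc]
    have : β h * (β h⁻¹ * (β g * (X * (β g⁻¹ * β h)))) = (β h * β h⁻¹) * (β g * (X * (β g⁻¹ * β h))) := by
      simp only [mul_assoc]
    rw [this, ← map_mul β h, mul_inv_cancel, map_one, one_mul]
  have havg2 : ∀ X : Matrix (Fin 2) (Fin 2) ℂ, ∑ g, β g * X * β g⁻¹ = ((Nat.card H : ℂ) * X.trace / 2) • 1 := by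
    intro X
    obtain ⟨c, hc⟩ := havg X
    have h1 := congrArg Matrix.trace hc
    rw [Matrix.trace_sum] at h1
    have h2 : ∀ g : H, (β g * X * β g⁻¹).trace = X.trace := by
      intro g
      rw [Matrix.trace_mul_comm, ← mul_assoc, ← map_mul]; simp
    simp only [h2] at h1
    simp at h1
    rw [hc, Nat.card_eq_fintype_card, h1]
    congr 1
    ring
  have hsum : ∑ g, (β g).trace * (β g⁻¹).trace = Nat.card H := by
    have e : ∀ i j : Fin 2, ∑ g, β g i i * β g⁻¹ j j = if i = j then (Nat.card H : ℂ) / 2 else 0 := by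
      intro i j
      have h1 := congrFun (congrFun (havg2 (Matrix.single i j 1)) i) j
      rw [Matrix.sum_apply] at h1
      have h2 : ∀ g : H, (β g * Matrix.single i j 1 * β g⁻¹ : Matrix (Fin 2) (Fin 2) ℂ) i j = β g i i * β g⁻¹ j j := by
        intro g
        rw [Matrix.mul_apply]
        rw [Finset.sum_eq_single j]
        · simp
        · intro k _ hk
          rw [Matrix.mul_single_apply_of_ne _ _ _ _ _ hk]; simp
        · simp
      simp only [h2] at h1
      rw [h1]
      by_cases hij : i = j
      · subst hij; simp
      · simp [hij]
    simp only [Matrix.trace_fin_two, add_mul, mul_add, Finset.sum_add_distrib, e]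
    simp
  obtain ⟨z, hz, hz2⟩ := odd_sum_inv hodd (fun g => (β g).trace * (β g⁻¹).trace)
    (by intro g; simp [mul_comm]) (by
      intro g
      have : ∀ g : H, IsIntegral ℤ (β g).trace := fun g =>
        trace_int (β g) (Nat.card H) Nat.card_pos.ne' (by rw [← map_pow, pow_card_eq_one', map_one])
      exact (this g).mul (this g⁻¹))
  rw [hsum] at hz2
  refine half_not_int (2 + z) ?_ (Nat.card H) hodd ?_
  · exact IsIntegral.add (by simpa using isIntegral_algebraMap (R := ℤ) (x := 2) (A := ℂ)) hz
  · rw [hz2]; simp; ring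

/-- weight space -/
def wtSp {A V : Type*} [Group A] [AddCommGroup V] [Module ℂ V] (ρ : A →* Module.End ℂ V)
    (φ : A →* ℂˣ) : Submodule ℂ V where
  carrier := {v | ∀ a, ρ a v = (φ a : ℂ) • v}
  add_mem' := by
    intro x y hx hy a
    rw [map_add, hx a, hy a, smul_add]
  zero_mem' := by intro a; simp
  smul_mem' := by
    intro c x hx a
    rw [map_smul, hx a, smul_comm]

theorem mem_wtSp {A V : Type*} [Group A] [AddCommGroup V] [Module ℂ V] (ρ : A →* Module.End ℂ V)
    (φ : A →* ℂˣ) (v : V) : v ∈ wtSp ρ φ ↔ ∀ a, ρ a v = (φ a : ℂ) • v := Iff.rfl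

theorem char_sum {A : Type*} [Group A] [Finite A] (hc : ∀ a b : A, a * b = b * a)
    [Fintype (A →* ℂˣ)] [DecidableEq A] (a : A) :
    ∑ φ : A →* ℂˣ, (φ a : ℂ) = if a = 1 then (Nat.card A : ℂ) else 0 := by
  let _ : CommGroup A := { ‹Group A› with mul_comm := hc }
  split_ifs with h
  · subst h
    simp only [map_one, Units.val_one, Finset.sum_const, nsmul_eq_mul, mul_one]
    have := CommGroup.card_monoidHom_of_hasEnoughRootsOfUnity A ℂ
    rw [← this, Nat.card_eq_fintype_card]
    simp
  · obtain ⟨ψ, hψ⟩ := CommGroup.exists_apply_ne_one_of_hasEnoughRootsOfUnity A ℂ h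
    have h1 : ∑ φ : A →* ℂˣ, (φ a : ℂ) = (ψ a : ℂ) * ∑ φ : A →* ℂˣ, (φ a : ℂ) := by
      rw [Finset.mul_sum]
      refine Fintype.sum_equiv (Equiv.mulLeft ψ⁻¹) _ _ ?_
      intro φ
      simp
    have h2 : ((ψ a : ℂ) - 1) * ∑ φ : A →* ℂˣ, (φ a : ℂ) = 0 := by linear_combination -h1
    rcases mul_eq_zero.mp h2 with h3 | h3
    · exact absurd (Units.ext (by simpa using sub_eq_zero.mp h3)) hψ
    · exact h3

theorem wt_sum {A V : Type*} [Group A] [Finite A] [AddCommGroup V] [Module ℂ V]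
    [FiniteDimensional ℂ V] (hc : ∀ a b : A, a * b = b * a) [Fintype (A →* ℂˣ)]
    (ρ : A →* Module.End ℂ V) :
    ∑ φ : A →* ℂˣ, Module.finrank ℂ (wtSp ρ φ) = Module.finrank ℂ V := by
  classical
  have := Fintype.ofFinite A
  have hN : (Nat.card A : ℂ) ≠ 0 := by exact_mod_cast Nat.card_pos.ne'
  let e : (A →* ℂˣ) → Module.End ℂ V := fun φ =>
    (Nat.card A : ℂ)⁻¹ • ∑ a, ((φ a⁻¹ : ℂˣ) : ℂ) • ρ a
  have hproj : ∀ φ, LinearMap.IsProj (wtSp ρ φ) (e φ) := by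
    intro φ
    constructor
    · intro v b
      simp only [e, LinearMap.smul_apply, map_smul, LinearMap.sum_apply, map_sum]
      rw [smul_comm]
      congr 1
      rw [Finset.smul_sum]
      refine Fintype.sum_equiv (Equiv.mulLeft b) _ _ ?_
      intro a
      simp only [Equiv.coe_mulLeft, mul_inv_rev, map_mul, Module.End.mul_apply, smul_smul]
      congr 1
      push_cast
      rw [map_inv]
      simp
      field_simp
    · intro v hv
      simp only [e, LinearMap.smul_apply, LinearMap.sum_apply]
      have : ∀ a, ((φ a⁻¹ : ℂˣ) : ℂ) • ρ a v = v := by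
        intro a
        rw [(mem_wtSp _ _ _).mp hv a, smul_smul, ← Units.val_mul, ← map_mul]
        simp
      simp only [this]
      simp only [Finset.sum_const, Finset.card_univ, ← Nat.card_eq_fintype_card]
      rw [← Nat.cast_smul_eq_nsmul ℂ, smul_smul, inv_mul_cancel₀ hN, one_smul]
  have hsum : ∑ φ, e φ = 1 := by
    simp only [e]
    rw [← Finset.smul_sum, Finset.sum_comm]
    simp only [← Finset.sum_smul, char_sum hc, inv_eq_one]
    simp [smul_smul]
  have h1 := congrArg (LinearMap.trace ℂ V) hsum
  rw [map_sum, LinearMap.trace_one] at h1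
  have h2 : ∀ φ, LinearMap.trace ℂ V (e φ) = Module.finrank ℂ (wtSp ρ φ) := fun φ => (hproj φ).trace
  simp only [h2] at h1
  exact_mod_cast h1

theorem wt_exists {A V : Type*} [Group A] [Finite A] [AddCommGroup V] [Module ℂ V]
    [FiniteDimensional ℂ V] [Nontrivial V] (hc : ∀ a b : A, a * b = b * a)
    (ρ : A →* Module.End ℂ V) : ∃ (φ : A →* ℂˣ) (v : V), v ≠ 0 ∧ ∀ a, ρ a v = (φ a : ℂ) • v := by
  have := Fintype.ofFinite (A →* ℂˣ)
  have h1 := wt_sum hc ρ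
  have h2 : 0 < Module.finrank ℂ V := Module.finrank_pos
  rw [← h1] at h2
  obtain ⟨φ, -, hφ⟩ := Finset.exists_ne_zero_of_sum_ne_zero h2.ne'
  have : Nontrivial (wtSp ρ φ) := Module.nontrivial_of_finrank_pos (Nat.pos_of_ne_zero hφ)
  obtain ⟨v, hv⟩ := exists_ne (0 : wtSp ρ φ)
  exact ⟨φ, v, by simpa using hv, v.2⟩

/-- conjugate of a character of a normal subgroup -/
def cjChar {G : Type*} [Group G] {K : Subgroup G} [K.Normal] (g : G) (φ : K →* ℂˣ) : K →* ℂˣ :=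
  φ.comp (MulAut.conjNormal g⁻¹ : MulAut K).toMonoidHom

theorem cjChar_apply {G : Type*} [Group G] {K : Subgroup G} [K.Normal] (g : G) (φ : K →* ℂˣ) (k : K) :
    cjChar g φ k = φ (MulAut.conjNormal g⁻¹ k) := rfl

theorem cjChar_one {G : Type*} [Group G] {K : Subgroup G} [K.Normal] (φ : K →* ℂˣ) :
    cjChar (1 : G) φ = φ := by
  ext k; simp [cjChar_apply]

theorem cjChar_mul {G : Type*} [Group G] {K : Subgroup G} [K.Normal] (a b : G) (φ : K →* ℂˣ) :
    cjChar (a * b) φ = cjChar a (cjChar b φ) := by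
  ext k; simp [cjChar_apply]

theorem wt_conj {G V : Type*} [Group G] [AddCommGroup V] [Module ℂ V]
    (ρ : G →* Module.End ℂ V) (K : Subgroup G) [K.Normal] (φ : K →* ℂˣ) (g : G) (v : V)
    (hv : v ∈ wtSp (ρ.comp K.subtype) φ) : ρ g v ∈ wtSp (ρ.comp K.subtype) (cjChar g φ) := by
  intro k
  have h := hv (MulAut.conjNormal g⁻¹ k)
  rw [cjChar_apply, ← map_smul, ← h]
  simp only [MonoidHom.comp_apply, Subgroup.subtype_apply, MulAut.conjNormal_apply, ← Module.End.mul_apply, ← map_mul]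
  congr 2
  group

theorem wt_conj_le {G V : Type*} [Group G] [AddCommGroup V] [Module ℂ V] [FiniteDimensional ℂ V]
    (ρ : G →* Module.End ℂ V) (K : Subgroup G) [K.Normal] (φ : K →* ℂˣ) (g : G) :
    Module.finrank ℂ (wtSp (ρ.comp K.subtype) φ) ≤
      Module.finrank ℂ (wtSp (ρ.comp K.subtype) (cjChar g φ)) := by
  have hinj : Function.Injective (ρ g) := by
    intro a b hab
    have := congrArg (ρ g⁻¹) hab
    simpa [← Module.End.mul_apply, ← map_mul] using this
  refine LinearMap.finrank_le_finrank_of_injective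
    (f := (ρ g).restrict (p := wtSp (ρ.comp K.subtype) φ)
      (q := wtSp (ρ.comp K.subtype) (cjChar g φ)) (fun v hv => wt_conj ρ K φ g v hv)) ?_
  intro a b hab
  apply Subtype.ext
  apply hinj
  exact congrArg Subtype.val hab

theorem common_eig {G V : Type*} [Group G] [Finite G] [AddCommGroup V] [Module ℂ V]
    [FiniteDimensional ℂ V] (hV : Odd (Module.finrank ℂ V)) (ρ : G →* Module.End ℂ V)
    (K S : Subgroup G) [K.Normal] (hK : ∀ a b : K, a * b = b * a) (hS : ∀ a b : S, a * b = b * a)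
    (hS2 : IsPGroup 2 S) (hKS : ∀ g : G, ∃ k ∈ K, ∃ s ∈ S, g = k * s) :
    ∃ v : V, v ≠ 0 ∧ ∀ g, ∃ c : ℂ, ρ g v = c • v := by
  classical
  have := Fintype.ofFinite (K →* ℂˣ)
  let n : (K →* ℂˣ) → ℕ := fun φ => Module.finrank ℂ (wtSp (ρ.comp K.subtype) φ)
  have hn : ∀ (g : G) φ, n (cjChar g φ) = n φ := by
    intro g φ
    apply le_antisymm
    · have := wt_conj_le ρ K (cjChar g φ) g⁻¹
      rwa [← cjChar_mul, inv_mul_cancel, cjChar_one] at this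
    · exact wt_conj_le ρ K φ g
  have hsum := wt_sum hK (ρ.comp K.subtype)
  rw [← hsum, Finset.odd_sum_iff_odd_card_odd] at hV
  let X := {φ : K →* ℂˣ // Odd (n φ)}
  let _ : MulAction S X :=
    { smul := fun s φ => ⟨cjChar (s : G) φ.1, by rw [hn]; exact φ.2⟩
      one_smul := fun φ => Subtype.ext (cjChar_one _)
      mul_smul := fun a b φ => Subtype.ext (cjChar_mul _ _ _) }
  have hX : Odd (Nat.card X) := by
    have : Nat.card X = (Finset.univ.filter (fun φ => Odd (n φ))).card := by
      rw [Nat.card_eq_fintype_card, Fintype.card_subtype]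
    rw [this]; exact hV
  have hfp := hS2.card_modEq_card_fixedPoints X
  have hne : (MulAction.fixedPoints S X).Nonempty := by
    rw [Set.nonempty_iff_ne_empty]
    intro he
    have h0 : Nat.card (∅ : Set X) = 0 := by simp
    rw [he, h0] at hfp
    unfold Nat.ModEq at hfp
    obtain ⟨r, hr⟩ := hX
    omega
  obtain ⟨⟨φ, hφ⟩, hfix⟩ := hne
  have hfix' : ∀ s : S, cjChar (s : G) φ = φ := fun s => congrArg Subtype.val (hfix s)
  let W := wtSp (ρ.comp K.subtype) φ
  have : Nontrivial W := Module.nontrivial_of_finrank_pos hφ.pos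
  have hW : ∀ (s : S) (v : V), v ∈ W → ρ s v ∈ W := by
    intro s v hv
    have := wt_conj ρ K φ (s : G) v hv
    rwa [hfix'] at this
  let σ : S →* Module.End ℂ W :=
    { toFun := fun s => (ρ s).restrict (hW s)
      map_one' := by ext v; simp
      map_mul' := by intro a b; ext v; simp }
  obtain ⟨ψ, v, hv, hψ⟩ := wt_exists hS σ
  refine ⟨v, by simpa using hv, ?_⟩
  intro g
  obtain ⟨k, hk, s, hs, rfl⟩ := hKS g
  refine ⟨φ ⟨k, hk⟩ * ψ ⟨s, hs⟩, ?_⟩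
  have h1 : ρ s v = (ψ ⟨s, hs⟩ : ℂ) • (v : V) := congrArg Subtype.val (hψ ⟨s, hs⟩)
  have h2 : ρ k v = (φ ⟨k, hk⟩ : ℂ) • (v : V) := v.2 ⟨k, hk⟩
  rw [map_mul, Module.End.mul_apply, h1, map_smul, h2, smul_smul, mul_comm]

theorem exists_pair {G V : Type*} [Group G] [Finite G] [AddCommGroup V] [Module ℂ V]
    [FiniteDimensional ℂ V] (hV : Module.finrank ℂ V = 3) (ρ : G →* Module.End ℂ V)
    (hρ : Function.Injective ρ) (v : V) (hv : v ≠ 0) (hg : ∀ g, ∃ c : ℂ, ρ g v = c • v) :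
    ∃ (β : G →* Matrix (Fin 2) (Fin 2) ℂ) (χ : G →* ℂ), ∀ g, β g = 1 → χ g = 1 → g = 1 := by
  classical
  choose c hc using hg
  have hsm : ∀ a b : ℂ, a • v = b • v → a = b := fun a b h => smul_left_injective ℂ hv h
  let χ : G →* ℂ :=
    { toFun := c
      map_one' := by apply hsm; rw [← hc]; simp
      map_mul' := by
        intro a b
        apply hsm
        rw [← hc, map_mul, Module.End.mul_apply, hc b, map_smul, hc a, smul_smul, mul_comm] }
  let W := Submodule.span ℂ {v}
  have hW : ∀ g, W ≤ W.comap (ρ g) := by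
    intro g
    rw [Submodule.span_singleton_le_iff_mem, Submodule.mem_comap, hc]
    exact Submodule.smul_mem _ _ (Submodule.mem_span_singleton_self v)
  have hQ : Module.finrank ℂ (V ⧸ W) = 2 := by
    have h1 := Submodule.finrank_quotient_add_finrank W
    have h2 : Module.finrank ℂ W = 1 := finrank_span_singleton hv
    omega
  let b := Module.finBasisOfFinrankEq ℂ (V ⧸ W) hQ
  let β : G →* Matrix (Fin 2) (Fin 2) ℂ :=
    { toFun := fun g => LinearMap.toMatrixAlgEquiv b (W.mapQ W (ρ g) (hW g))
      map_one' := by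
        rw [← map_one (LinearMap.toMatrixAlgEquiv b)]
        congr 1
        ext x
        simp
      map_mul' := by
        intro g h
        rw [← map_mul (LinearMap.toMatrixAlgEquiv b)]
        congr 1
        ext x
        simp }
  refine ⟨β, χ, ?_⟩
  intro g h1 h2
  have h3 : W.mapQ W (ρ g) (hW g) = 1 := by
    apply (LinearMap.toMatrixAlgEquiv b).injective
    rw [map_one]; exact h1
  have h4 : ∀ x, ρ g x - x ∈ W := by
    intro x
    have := LinearMap.congr_fun h3 (Submodule.Quotient.mk x)
    rw [Submodule.mapQ_apply] at this
    exact (Submodule.Quotient.eq W).mp this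
  have h5 : ρ g v = v := by rw [hc]; change χ g • v = v; rw [h2, one_smul]
  apply hρ
  rw [map_one]
  apply unip (ρ g) (Nat.card G) Nat.card_pos.ne'
  · ext x
    obtain ⟨a, ha⟩ := Submodule.mem_span_singleton.mp (h4 x)
    rw [Module.End.mul_apply]
    simp only [LinearMap.sub_apply, Module.End.one_apply]
    rw [← ha]
    simp [h5]
  · rw [← map_pow, pow_card_eq_one', map_one]

theorem scalar_of_comm {A B C : Matrix (Fin 2) (Fin 2) ℂ} (h : B * C ≠ C * B)
    (hB : A * B = B * A) (hC : A * C = C * A) : ∃ c : ℂ, A = c • 1 := by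
  by_contra hA
  exact h (cent_comm A B C hA hB hC)

theorem scalar_pow {u : Matrix (Fin 2) (Fin 2) ℂ} {c : ℂ} (h : u = c • 1) (n : ℕ) :
    u ^ n = c ^ n • 1 := by
  rw [h, smul_pow, one_pow]

theorem scalar_one {c d : ℂ} (h : c • (1 : Matrix (Fin 2) (Fin 2) ℂ) = d • 1) : c = d := by
  have := congrFun (congrFun h 0) 0
  simpa using this

/-- a nonabelian subgroup of `GL₂` has cyclic centre -/
theorem no_emb {H : Type*} [Group H] (γ : H →* Matrix (Fin 2) (Fin 2) ℂ) (hγ : Function.Injective γ)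
    (x s u v : H) (hxs : x * s ≠ s * x) (hux : u * x = x * u) (hus : u * s = s * u)
    (hvx : v * x = x * v) (hvs : v * s = s * v) (p : ℕ) (hp : p.Prime) (hu : u ^ p = 1) (hu1 : u ≠ 1)
    (hv : v ^ p = 1) (hvu : v ∉ Subgroup.zpowers u) : False := by
  have hne : γ x * γ s ≠ γ s * γ x := by
    rw [← map_mul, ← map_mul]; exact fun h => hxs (hγ h)
  obtain ⟨a, ha⟩ := scalar_of_comm (A := γ u) hne (by simp only [← map_mul, hux]) (by simp only [← map_mul, hus])
  obtain ⟨b, hb⟩ := scalar_of_comm (A := γ v) hne (by simp only [← map_mul, hvx]) (by simp only [← map_mul, hvs])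
  have ha' : a ^ p = 1 := by
    apply scalar_one; rw [← scalar_pow ha, ← map_pow, hu]; simp
  have hb' : b ^ p = 1 := by
    apply scalar_one; rw [← scalar_pow hb, ← map_pow, hv]; simp
  have ha1 : a ≠ 1 := by
    rintro rfl
    apply hu1; apply hγ; rw [ha]; simp
  have hprim : IsPrimitiveRoot a p := by
    rw [← orderOf_eq_prime (hp := ⟨hp⟩) ha' ha1]; exact IsPrimitiveRoot.orderOf a
  have : NeZero p := ⟨hp.ne_zero⟩
  obtain ⟨i, -, hi⟩ := hprim.eq_pow_of_pow_eq_one hb'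
  apply hvu
  rw [Subgroup.mem_zpowers_iff]
  refine ⟨i, ?_⟩
  apply hγ
  rw [zpow_natCast, map_pow, scalar_pow ha, hi, hb]

theorem ch2 (x : Matrix (Fin 2) (Fin 2) ℂ) : x * x = x.trace • x - x.det • 1 := by
  ext i j
  fin_cases i <;> fin_cases j <;>
    simp [Matrix.mul_apply, Matrix.trace_fin_two, Matrix.det_fin_two] <;> ring

/-- elementary abelian subgroups of `GL₂` have rank at most two -/
theorem elem_card {E : Type*} [Group E] [Finite E] (γ : E →* Matrix (Fin 2) (Fin 2) ℂ)
    (hγ : Function.Injective γ) (hc : ∀ a b : E, a * b = b * a) (p : ℕ) (hp : p.Prime)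
    (he : ∀ e : E, e ^ p = 1) : Nat.card E ≤ p ^ 2 := by
  classical
  have : NeZero p := ⟨hp.ne_zero⟩
  let ρ : E →* Module.End ℂ (Fin 2 → ℂ) := (Matrix.toLinAlgEquiv' (R := ℂ) (n := Fin 2)).toMulEquiv.toMonoidHom.comp γ
  have hρ : ∀ (e : E) (v : Fin 2 → ℂ), ρ e v = Matrix.mulVec (γ e) v := fun e v => by
    simp [ρ]
  obtain ⟨φ, v, hv, hφ⟩ := wt_exists hc ρ
  let δ : E →* ℂˣ := MonoidHom.toHomUnits (Matrix.detMonoidHom.comp γ)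
  have hδ : ∀ e, (δ e : ℂ) = (γ e).det := fun e => rfl
  let F : E → rootsOfUnity p ℂ × rootsOfUnity p ℂ := fun e =>
    (⟨φ e, by rw [mem_rootsOfUnity, ← map_pow, he, map_one]⟩,
      ⟨δ e, by rw [mem_rootsOfUnity, ← map_pow, he, map_one]⟩)
  have key : ∀ e : E, φ e = 1 → δ e = 1 → e = 1 := by
    intro e h1 h2
    have hd : (γ e).det = 1 := by rw [← hδ, h2]; rfl
    have hev : Matrix.mulVec (γ e - 1) v = 0 := by
      rw [Matrix.sub_mulVec, ← hρ, hφ, h1]; simp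
    have hdet : (γ e - 1).det = 0 := Matrix.exists_mulVec_eq_zero_iff.mp ⟨v, hv, hev⟩
    have htr : (γ e).trace = 2 := by
      rw [Matrix.det_fin_two] at hdet hd
      simp at hdet
      rw [Matrix.trace_fin_two]
      linear_combination -hdet + hd
    apply hγ
    rw [map_one]
    apply unip (γ e) p hp.ne_zero
    · have := ch2 (γ e)
      rw [hd, htr] at this
      rw [sub_mul, mul_sub, this, two_smul]
      simp
      abel
    · rw [← map_pow, he, map_one]
  have hF : Function.Injective F := by
    intro a b hab
    have h1 : φ a = φ b := congrArg (fun z => (z.1 : ℂˣ)) hab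
    have h2 : δ a = δ b := congrArg (fun z => (z.2 : ℂˣ)) hab
    have := key (a * b⁻¹) (by rw [map_mul, map_inv, h1]; simp) (by rw [map_mul, map_inv, h2]; simp)
    exact mul_inv_eq_one.mp this
  have h1 := Nat.card_le_card_of_injective F hF
  have h2 : Nat.card (rootsOfUnity p ℂ) ≤ p := card_rootsOfUnity ℂ p
  rw [Nat.card_prod] at h1
  nlinarith

/-- prime torsion witness for noncyclic abelian groups -/
theorem noncyclic_torsion {Z : Type*} [CommGroup Z] [Finite Z] (h : ¬ IsCyclic Z) :
    ∃ p : ℕ, p.Prime ∧ ∃ u v : Z, u ^ p = 1 ∧ u ≠ 1 ∧ v ^ p = 1 ∧ v ∉ Subgroup.zpowers u := by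
  classical
  by_contra hcon
  push Not at hcon
  apply h
  have := Fintype.ofFinite Z
  have hker : ∀ n : ℕ, Nat.card (powMonoidHom n : Z →* Z).ker = (Finset.univ.filter (fun a : Z => a ^ n = 1)).card := by
    intro n
    rw [Nat.card_eq_fintype_card, Fintype.card_subtype]
    congr 1
    ext a
    simp [MonoidHom.mem_ker]
  have hprime : ∀ p : ℕ, p.Prime → Nat.card (powMonoidHom p : Z →* Z).ker ≤ p := by
    intro p hp
    by_cases h1 : ∃ u : Z, u ^ p = 1 ∧ u ≠ 1
    · obtain ⟨u, hu, hu1⟩ := h1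
      have h2 : (powMonoidHom p : Z →* Z).ker ≤ Subgroup.zpowers u := by
        intro v hv
        exact hcon p hp u v hu hu1 hv
      have h3 := Subgroup.card_le_of_le h2
      rw [Nat.card_zpowers, orderOf_eq_prime (hp := ⟨hp⟩) hu hu1] at h3
      exact h3
    · push Not at h1
      have : (powMonoidHom p : Z →* Z).ker = ⊥ := by
        rw [eq_bot_iff]; intro v hv; exact h1 v hv
      rw [this]; simp [hp.one_le]
  have hall : ∀ n : ℕ, 0 < n → Nat.card (powMonoidHom n : Z →* Z).ker ≤ n := by
    intro n
    induction n using Nat.recOnMul with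
    | zero => intro h; omega
    | one =>
      intro _
      have : (powMonoidHom 1 : Z →* Z).ker = ⊥ := by
        rw [eq_bot_iff]; intro v hv
        have : v ^ 1 = 1 := hv
        simpa using this
      rw [this]; simp
    | prime p hp => intro _; exact hprime p hp
    | mul a b iha ihb =>
      intro hab
      have ha := Nat.pos_of_mul_pos_right hab
      have hb := Nat.pos_of_mul_pos_left hab
      have key : Nat.card (powMonoidHom (a * b) : Z →* Z).ker ≤
          Nat.card (powMonoidHom a : Z →* Z).ker * Nat.card (powMonoidHom b : Z →* Z).ker := by
        let f : (powMonoidHom (a * b) : Z →* Z).ker →* Z := (powMonoidHom a).comp (Subgroup.subtype _)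
        rw [← Subgroup.card_mul_index f.ker, Subgroup.index_ker]
        apply Nat.mul_le_mul
        · refine Nat.card_le_card_of_injective
            (fun z : f.ker => (⟨z.1.1, z.2⟩ : (powMonoidHom a : Z →* Z).ker)) ?_
          intro x y hxy
          have h1 : x.1.1 = y.1.1 := congrArg (fun w : (powMonoidHom a : Z →* Z).ker => (w : Z)) hxy
          exact Subtype.ext (Subtype.ext h1)
        · apply Subgroup.card_le_of_le
          rintro _ ⟨z, rfl⟩
          have hz : (z : Z) ^ (a * b) = 1 := z.2
          rw [pow_mul] at hz
          exact hz
      exact key.trans (Nat.mul_le_mul (iha ha) (ihb hb))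
  exact isCyclic_of_card_pow_eq_one_le (fun n hn => by rw [← hker]; exact hall n hn)

theorem center_scalar {G : Type*} [Group G] (hna : ¬ ∀ a b : G, a * b = b * a)
    (β : G →* Matrix (Fin 2) (Fin 2) ℂ) (χ : G →* ℂ) (hinj : ∀ g, β g = 1 → χ g = 1 → g = 1)
    (z : G) (hz : ∀ g, z * g = g * z) : ∃ c : ℂ, β z = c • 1 := by
  push Not at hna
  obtain ⟨a, b, hab⟩ := hna
  apply scalar_of_comm (B := β a) (C := β b)
  · intro h
    apply hab
    have : a * b * (b * a)⁻¹ = 1 := by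
      apply hinj
      · rw [map_mul, map_mul, h, ← map_mul, ← map_mul, mul_inv_cancel, map_one]
      · rw [map_mul, map_mul, mul_comm (χ a), ← map_mul, ← map_mul, mul_inv_cancel, map_one]
    exact mul_inv_eq_one.mp this
  · rw [← map_mul, hz, map_mul]
  · rw [← map_mul, hz, map_mul]

theorem comm_kills {G M : Type*} [Group G] [CommMonoid M] (f : G →* M) (g : G) (hg : g ∈ commutator G) :
    f g = 1 := by
  have h := Abelianization.commutator_subset_ker (f.toHomUnits) hg
  rw [MonoidHom.mem_ker] at h
  exact congrArg Units.val h

theorem pow_odd_one {M : Type*} [Monoid M] (x : M) (n : ℕ) (hn : Odd n) (h : x ^ n = 1) (h2 : x ^ 2 = 1) : x = 1 := by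
  obtain ⟨k, rfl⟩ := hn
  rwa [pow_add, pow_mul, h2, one_pow, one_mul, pow_one] at h

theorem scalar_comm_one {G : Type*} [Group G] [Finite G] 
    (hodd : Odd (Nat.card (commutator G)))
    (β : G →* Matrix (Fin 2) (Fin 2) ℂ) (χ : G →* ℂ) (hinj : ∀ g, β g = 1 → χ g = 1 → g = 1)
    (z : G) (hz : z ∈ commutator G) (c : ℂ) (hc : β z = c • 1) : z = 1 := by
  apply hinj _ _ (comm_kills χ z hz)
  have h1 : (β z).det = 1 := comm_kills (Matrix.detMonoidHom.comp β) z hz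
  rw [hc, Matrix.det_smul] at h1
  simp only [Fintype.card_fin, Matrix.det_one, mul_one] at h1
  have h2 : z ^ Nat.card (commutator G) = 1 := by
    have := pow_card_eq_one' (x := (⟨z, hz⟩ : commutator G))
    exact congrArg Subtype.val this
  have h3 : c ^ Nat.card (commutator G) = 1 := by
    apply scalar_one; rw [← scalar_pow hc, ← map_pow, h2]; simp
  have h4 := pow_odd_one c _ hodd h3 h1
  rw [hc, h4, one_smul]

theorem cyclic_char {Z : Type*} [Group Z] [Finite Z] [IsCyclic Z] :
    ∃ f : Z →* ℂˣ, Function.Injective f := by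
  have : NeZero (Nat.card Z) := ⟨Nat.card_pos.ne'⟩
  have hc : Nat.card Z = Nat.card (rootsOfUnity (Nat.card Z) ℂ) := by
    rw [Complex.card_rootsOfUnity]
  let e := mulEquivOfCyclicCardEq hc
  exact ⟨(Subgroup.subtype _).comp e.toMonoidHom, fun a b hab => e.injective (Subtype.ext hab)⟩

theorem twist {G : Type*} [Group G] [Finite G] (hna : ¬ ∀ a b : G, a * b = b * a)
    (hodd : Odd (Nat.card (commutator G)))
    (β : G →* Matrix (Fin 2) (Fin 2) ℂ) (χ : G →* ℂ) (hinj : ∀ g, β g = 1 → χ g = 1 → g = 1)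
    (hcyc : IsCyclic (Subgroup.center G)) :
    ∃ γ : G →* Matrix (Fin 2) (Fin 2) ℂ, Function.Injective γ := by
  have hzc : ∀ z : Subgroup.center G, ∃ c : ℂ, β z = c • 1 := fun z =>
    center_scalar hna β χ hinj z (fun g => ((Subgroup.mem_center_iff.mp z.2) g).symm)
  choose ω hω using hzc
  let ω' : Subgroup.center G →* ℂˣ := MonoidHom.toHomUnits
    { toFun := ω
      map_one' := by apply scalar_one; rw [← hω]; simp
      map_mul' := by
        intro a b
        apply scalar_one
        rw [← hω]
        simp [hω, smul_smul, mul_comm] }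
  have hω' : ∀ z, (ω' z : ℂ) = ω z := fun z => rfl
  obtain ⟨ψ, hψ⟩ := cyclic_char (Z := Subgroup.center G)
  let j : Subgroup.center G →* Abelianization G := Abelianization.of.comp (Subgroup.subtype _)
  have hj : Function.Injective j := by
    rw [injective_iff_map_eq_one]
    intro z hz
    have : (z : G) ∈ commutator G := (QuotientGroup.eq_one_iff _).mp hz
    exact Subtype.ext (scalar_comm_one hodd β χ hinj z this (ω z) (hω z))
  let e := MonoidHom.ofInjective hj
  obtain ⟨μ, hμ⟩ := MonoidHom.domRestrict_surjective ℂ j.range ((ψ * ω'⁻¹).comp e.symm.toMonoidHom)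
  have hμ' : ∀ z : Subgroup.center G, μ (j z) = ψ z * (ω' z)⁻¹ := by
    intro z
    have h0 := DFunLike.congr_fun hμ (e z)
    have h1 : μ (j z) = (ψ * ω'⁻¹) (e.symm (e z)) := h0
    rw [MulEquiv.symm_apply_apply] at h1
    exact h1
  let lam : G →* ℂˣ := μ.comp Abelianization.of
  refine ⟨{ toFun := fun g => (lam g : ℂ) • β g
            map_one' := by simp
            map_mul' := by intro a b; simp [smul_smul, mul_comm] }, ?_⟩
  rw [injective_iff_map_eq_one]
  intro g hg
  change (lam g : ℂ) • β g = 1 at hg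
  have hs : β g = ((lam g)⁻¹ : ℂˣ).val • 1 := by
    rw [← hg, smul_smul, ← Units.val_mul, inv_mul_cancel, Units.val_one, one_smul]
  have hgz : g ∈ Subgroup.center G := by
    rw [Subgroup.mem_center_iff]
    intro h
    apply mul_inv_eq_one.mp
    apply hinj
    · have h1 : β h * β g = β g * β h := by rw [hs]; simp
      rw [map_mul, map_mul, h1, ← map_mul, ← map_mul, mul_inv_cancel, map_one]
    · rw [map_mul, map_mul, mul_comm (χ h), ← map_mul, ← map_mul, mul_inv_cancel, map_one]
  have h1 := hμ' ⟨g, hgz⟩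
  have h2 : μ (j ⟨g, hgz⟩) = lam g := rfl
  rw [h2] at h1
  have h3 : ((lam g)⁻¹ : ℂˣ) = ω' ⟨g, hgz⟩ := by
    apply Units.ext
    rw [hω']
    apply scalar_one
    rw [← hs, ← hω]
  rw [← h3, inv_inv] at h1
  have h4 : ψ ⟨g, hgz⟩ = 1 := by simpa using h1.symm
  have h5 := (injective_iff_map_eq_one ψ).mp hψ _ h4
  exact congrArg Subtype.val h5

theorem cent_span (X Y : Matrix (Fin 2) (Fin 2) ℂ) (hX : ¬ ∃ c : ℂ, X = c • 1)
    (h : X * Y = Y * X) : ∃ a b : ℂ, Y = a • 1 + b • X := by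
  have e1 := congrFun (congrFun h 0) 0
  have e2 := congrFun (congrFun h 0) 1
  have e3 := congrFun (congrFun h 1) 0
  simp only [Matrix.mul_apply, Fin.sum_univ_two] at e1 e2 e3
  have main : ∃ a b : ℂ, Y 0 0 = a + b * X 0 0 ∧ Y 0 1 = b * X 0 1 ∧ Y 1 0 = b * X 1 0 ∧
      Y 1 1 = a + b * X 1 1 := by
    by_cases h1 : X 0 1 = 0
    · by_cases h2 : X 1 0 = 0
      · have h3 : X 0 0 - X 1 1 ≠ 0 := by
          intro h3
          apply hX
          refine ⟨X 0 0, ?_⟩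
          ext i j
          fin_cases i <;> fin_cases j <;> simp [h1, h2]
          linear_combination -h3
        refine ⟨Y 0 0 - (Y 0 0 - Y 1 1) / (X 0 0 - X 1 1) * X 0 0,
          (Y 0 0 - Y 1 1) / (X 0 0 - X 1 1), by ring, ?_, ?_, ?_⟩
        · rw [h1, mul_zero]
          refine (mul_eq_zero.mp (?_ : (X 0 0 - X 1 1) * Y 0 1 = 0)).resolve_left h3
          rw [h1] at e2
          linear_combination e2
        · rw [h2, mul_zero]
          refine (mul_eq_zero.mp (?_ : (X 0 0 - X 1 1) * Y 1 0 = 0)).resolve_left h3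
          rw [h2] at e3
          linear_combination -e3
        · field_simp
          ring
      · refine ⟨Y 0 0 - Y 1 0 / X 1 0 * X 0 0, Y 1 0 / X 1 0, by ring, ?_, ?_, ?_⟩
        · field_simp
          linear_combination -e1
        · field_simp
        · field_simp
          linear_combination -e3
    · refine ⟨Y 0 0 - Y 0 1 / X 0 1 * X 0 0, Y 0 1 / X 0 1, by ring, ?_, ?_, ?_⟩
      · field_simp
      · field_simp
        linear_combination e1
      · field_simp
        linear_combination e2
  obtain ⟨a, b, h00, h01, h10, h11⟩ := main
  refine ⟨a, b, ?_⟩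
  ext i j
  fin_cases i <;> fin_cases j <;> simp [h00, h01, h10, h11]

theorem two_case (X Y : Matrix (Fin 2) (Fin 2) ℂ) (hX : ¬ ∃ c : ℂ, X = c • 1)
    (h : X * Y = Y * X) (hxd : X.det = 1) (hyd : Y.det = 1) (htr : Y.trace = X.trace)
    (ht : ¬ X.trace ^ 2 = 4) : Y = X ∨ Y = X.trace • 1 - X := by
  obtain ⟨a, b, rfl⟩ := cent_span X Y hX h
  have h1 : 2 * a + b * X.trace = X.trace := by
    simp only [Matrix.trace_fin_two, Matrix.add_apply, Matrix.smul_apply, Matrix.one_apply_eq, smul_eq_mul, mul_one] at htr ⊢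
    linear_combination htr
  have h2 : a ^ 2 + a * b * X.trace + b ^ 2 = 1 := by
    rw [Matrix.det_fin_two] at hyd hxd
    simp at hyd
    rw [Matrix.trace_fin_two]
    linear_combination hyd - b ^ 2 * hxd
  have h3 : (4 - X.trace ^ 2) * ((1 - b) * (1 + b)) = 0 := by
    linear_combination -4 * h2 + (2 * a + b * X.trace + X.trace) * h1
  have h4 : (4 - X.trace ^ 2) ≠ 0 := fun h => ht (by linear_combination -h)
  rcases mul_eq_zero.mp ((mul_eq_zero.mp h3).resolve_left h4) with h5 | h5
  · left
    have hb : b = 1 := by linear_combination -h5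
    have ha : a = 0 := by rw [hb] at h1; linear_combination h1 / 2
    rw [ha, hb]; simp
  · right
    have hb : b = -1 := by linear_combination h5
    have ha : a = X.trace := by rw [hb] at h1; linear_combination h1 / 2
    rw [ha, hb, neg_smul, one_smul, sub_eq_add_neg]

/-- noncommuting `k`, `s` give an inverted commutator -/
theorem inverted {G : Type*} [Group G] [Finite G] 
    (hodd : Odd (Nat.card (commutator G)))
    (β : G →* Matrix (Fin 2) (Fin 2) ℂ) (χ : G →* ℂ) (hinj : ∀ g, β g = 1 → χ g = 1 → g = 1)
    (K : Subgroup G) [hKn : K.Normal] (hK : ∀ a ∈ K, ∀ b ∈ K, a * b = b * a)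
    (k s : G) (hk : k ∈ K) (hks : k * s ≠ s * k) :
    ∃ x ∈ K, x ≠ 1 ∧ s * x * s⁻¹ = x⁻¹ := by
  have heq : ∀ a b : G, β a = β b → χ a = χ b → a = b := by
    intro a b h1 h2
    apply mul_inv_eq_one.mp
    apply hinj
    · rw [map_mul, h1, ← map_mul, mul_inv_cancel, map_one]
    · rw [map_mul, h2, ← map_mul, mul_inv_cancel, map_one]
  let x := k * s * k⁻¹ * s⁻¹
  have hx1 : x ≠ 1 := by
    intro h
    apply hks
    have h2 := mul_inv_eq_one.mp h
    exact mul_inv_eq_iff_eq_mul.mp h2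
  have hxK : x ∈ K := by
    have : s * k⁻¹ * s⁻¹ ∈ K := hKn.conj_mem _ (K.inv_mem hk) s
    have h2 := K.mul_mem hk this
    simpa only [x, mul_assoc] using h2
  have hxG : x ∈ commutator G := by
    have := Subgroup.commutator_mem_commutator (Subgroup.mem_top k) (Subgroup.mem_top s)
    exact this
  let y := s * x * s⁻¹
  have hyK : y ∈ K := hKn.conj_mem _ hxK s
  have hyG : y ∈ commutator G := (inferInstance : (commutator G).Normal).conj_mem _ hxG s
  have hns : ¬ ∃ c : ℂ, β x = c • 1 := by
    rintro ⟨c, hc⟩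
    exact hx1 (scalar_comm_one hodd β χ hinj x hxG c hc)
  have hxd : (β x).det = 1 := comm_kills (Matrix.detMonoidHom.comp β) x hxG
  have hyd : (β y).det = 1 := comm_kills (Matrix.detMonoidHom.comp β) y hyG
  have htr : (β y).trace = (β x).trace := by
    simp only [y]
    rw [map_mul, Matrix.trace_mul_comm, ← map_mul]
    congr 2
    group
  have hxy : β x * β y = β y * β x := by rw [← map_mul, ← map_mul, hK x hxK y hyK]
  have hxx := ch2 (β x)
  have hyy := ch2 (β y)
  rw [hxd] at hxx
  rw [hyd, htr] at hyy
  have hxinv : β x⁻¹ = (β x).trace • 1 - β x := by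
    have h1 : β x⁻¹ * (β x * β x) = β x := by
      rw [← mul_assoc, ← map_mul]; simp
    rw [hxx, mul_sub, mul_smul_comm, ← map_mul] at h1
    simp at h1
    rw [eq_sub_iff_add_eq, ← sub_eq_iff_eq_add'.mp h1]
  have hcases : β y = β x ∨ β y = β x⁻¹ := by
    by_cases ht : (β x).trace ^ 2 = 4
    · exfalso
      apply hns
      have hxn : x ^ Nat.card G = 1 := pow_card_eq_one'
      have ht2 : ((β x).trace - 2) * ((β x).trace + 2) = 0 := by linear_combination ht
      rcases mul_eq_zero.mp ht2 with h | h
      · have h2 : (β x).trace = 2 := by linear_combination h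
        refine ⟨1, ?_⟩
        rw [one_smul]
        apply unip _ (Nat.card G) Nat.card_pos.ne' _ (by rw [← map_pow, hxn, map_one])
        rw [sub_mul, mul_sub, hxx, h2, two_smul]
        simp
        abel
      · have h2 : (β x).trace = -2 := by linear_combination h
        refine ⟨-1, ?_⟩
        have : - β x = 1 := by
          apply unip _ (2 * Nat.card G) (by have := Nat.card_pos (α := G); omega)
          · have : (- β x - 1) * (- β x - 1) = β x * β x + (2 : ℂ) • β x + 1 := by
              rw [two_smul]; noncomm_ring
            rw [this, hxx, h2]
            module
          · rw [pow_mul, neg_sq, ← pow_mul, mul_comm 2, pow_mul, ← map_pow, hxn]; simp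
        rw [neg_smul, one_smul, ← this, neg_neg]
    · rw [hxinv]
      exact two_case _ _ hns hxy hxd hyd htr ht
  rcases hcases with h | h
  · exfalso
    have hyx : y = x := heq _ _ h ((comm_kills χ y hyG).trans (comm_kills χ x hxG).symm)
    have hsx : s * x = x * s := mul_inv_eq_iff_eq_mul.mp hyx
    apply hks
    apply heq
    · rw [map_mul, map_mul]
      exact cent_comm (β x) _ _ hns (by rw [← map_mul, ← map_mul, hK x hxK k hk])
        (by rw [← map_mul, ← map_mul, hsx])
    · rw [map_mul, map_mul, mul_comm]
  · refine ⟨x, hxK, hx1, heq _ _ h ?_⟩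
    rw [comm_kills χ y hyG, comm_kills χ x⁻¹ (Subgroup.inv_mem _ hxG)]

theorem pad {H : Type*} [Group H] {k n : ℕ} (hkn : k ≤ n) (ρ : H →* GL (Fin k) ℂ)
    (hρ : Function.Injective ρ) :
    ∃ γ : H →* Matrix (Fin n) (Fin n) ℂ, Function.Injective γ := by
  classical
  obtain ⟨d, rfl⟩ := Nat.exists_eq_add_of_le hkn
  let e : Matrix (Fin k ⊕ Fin d) (Fin k ⊕ Fin d) ℂ ≃ₐ[ℂ] Matrix (Fin (k + d)) (Fin (k + d)) ℂ :=
    Matrix.reindexAlgEquiv ℂ ℂ finSumFinEquiv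
  let f : H →* Matrix (Fin k ⊕ Fin d) (Fin k ⊕ Fin d) ℂ :=
    { toFun := fun h => Matrix.fromBlocks (ρ h).val 0 0 1
      map_one' := by simp
      map_mul' := by intro a b; simp [Matrix.fromBlocks_multiply] }
  refine ⟨(e : _ →* _).comp f, ?_⟩
  intro a b hab
  have h1 : f a = f b := e.injective hab
  apply hρ
  apply Units.ext
  exact (Matrix.fromBlocks_inj.mp h1).1

theorem proper_emb {G : Type*} [Group G] (h : MinFaithful G 3) (H : Subgroup G) (hH : H ≠ ⊤) :
    ∃ γ : H →* Matrix (Fin 2) (Fin 2) ℂ, Function.Injective γ := by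
  obtain ⟨h1, h2⟩ := h
  have hne : {n : ℕ | ∃ ρ : G →* GL (Fin n) ℂ, Function.Injective ρ}.Nonempty := by
    apply Nat.nonempty_of_pos_sInf
    change 0 < rdim G
    omega
  obtain ⟨n, ρ, hρ⟩ := hne
  have hmem : rdim H ∈ {n : ℕ | ∃ ρ : H →* GL (Fin n) ℂ, Function.Injective ρ} := by
    apply Nat.sInf_mem
    exact ⟨n, ρ.comp H.subtype, hρ.comp H.subtype_injective⟩
  obtain ⟨σ, hσ⟩ := hmem
  exact pad (Nat.le_of_lt_succ (h2 H hH)) σ hσ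

theorem full_emb {G : Type*} [Group G] (h : MinFaithful G 3) :
    ∃ ρ : G →* Matrix (Fin 3) (Fin 3) ℂ, Function.Injective ρ := by
  have hmem : rdim G ∈ {n : ℕ | ∃ ρ : G →* GL (Fin n) ℂ, Function.Injective ρ} := by
    apply Nat.sInf_mem
    apply Nat.nonempty_of_pos_sInf
    change 0 < rdim G
    rw [h.1]; omega
  obtain ⟨ρ, hρ⟩ := hmem
  exact pad h.1.le ρ hρ

theorem no_full_emb {G : Type*} [Group G] (h : MinFaithful G 3)
    (γ : G →* Matrix (Fin 2) (Fin 2) ℂ) (hγ : Function.Injective γ) : False := by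
  have : rdim G ≤ 2 := by
    apply Nat.sInf_le
    exact ⟨γ.toHomUnits, fun a b hab => hγ (congrArg Units.val hab)⟩
  rw [h.1] at this
  omega

theorem zmod_gen (n : ℕ) [NeZero n] (g : Multiplicative (ZMod n)) :
    ∃ k : ℕ, g = (Multiplicative.ofAdd (1 : ZMod n)) ^ k := by
  refine ⟨(Multiplicative.toAdd g).val, ?_⟩
  rw [← ofAdd_nsmul]
  simp

theorem zmod_hom {M : Type*} [Group M] (n : ℕ) (a : M) (ha : a ^ n = 1) :
    ∃ f : Multiplicative (ZMod n) →* M, f (Multiplicative.ofAdd 1) = a := by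
  refine ⟨AddMonoidHom.toMultiplicativeLeft (ZMod.lift n ⟨zmultiplesHom (Additive M) (Additive.ofMul a), ?_⟩), ?_⟩
  · simp only [zmultiplesHom_apply, natCast_zsmul]
    rw [← ofMul_pow, ha]; rfl
  · have := ZMod.lift_coe n (⟨zmultiplesHom (Additive M) (Additive.ofMul a), by
      simp only [zmultiplesHom_apply, natCast_zsmul]
      rw [← ofMul_pow, ha]; rfl⟩ : {f : ℤ →+ Additive M // f n = 0}) 1
    simp at this
    simp [this]

theorem zmod_hom_inj {M : Type*} [Group M] (n : ℕ) [NeZero n] (f : Multiplicative (ZMod n) →* M)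
    (hf : orderOf (f (Multiplicative.ofAdd 1)) = n) : Function.Injective f := by
  rw [injective_iff_map_eq_one]
  intro g hg
  obtain ⟨k, rfl⟩ := zmod_gen n g
  rw [map_pow] at hg
  have h1 := orderOf_dvd_of_pow_eq_one hg
  rw [hf] at h1
  rw [← ofAdd_nsmul]
  obtain ⟨c, rfl⟩ := h1
  simp

theorem conj_pow_inv {G : Type*} [Group G] (s x : G) (hsx : s * x * s⁻¹ = x⁻¹) (k : ℕ) :
    s * x ^ k * s⁻¹ = (x ^ k)⁻¹ := by
  rw [← conj_pow, hsx, inv_pow]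

theorem semi_hom {G : Type*} [Group G] (x s : G) (q m : ℕ) (hq : q.Prime) (hqo : Odd q)
    (hm : 1 ≤ m) (hx : orderOf x = q) (hs : orderOf s = 2 ^ m) (hsx : s * x * s⁻¹ = x⁻¹) :
    ∃ φ : Multiplicative (ZMod (2 ^ m)) →* MulAut (Multiplicative (ZMod q)),
      (∀ g : Multiplicative (ZMod q), φ (Multiplicative.ofAdd 1) g = g⁻¹) ∧
      ∃ F : (Multiplicative (ZMod q) ⋊[φ] Multiplicative (ZMod (2 ^ m))) →* G,
        Function.Injective F ∧ x ∈ F.range ∧ s ∈ F.range ∧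
        ∀ y, (∀ g, F y * g = g * F y) → F y ∈ Subgroup.zpowers s := by
  have : NeZero q := ⟨hq.ne_zero⟩
  obtain ⟨φ, hφ⟩ := zmod_hom (2 ^ m) (MulEquiv.inv (Multiplicative (ZMod q)) : MulAut (Multiplicative (ZMod q))) (by
    obtain ⟨m', rfl⟩ := Nat.exists_eq_add_of_le hm
    rw [pow_add, pow_one, pow_mul]
    have : (MulEquiv.inv (Multiplicative (ZMod q)) : MulAut (Multiplicative (ZMod q))) ^ 2 = 1 := by
      ext g; simp [pow_two]
    rw [this, one_pow])
  have hφ' : ∀ g : Multiplicative (ZMod q), φ (Multiplicative.ofAdd 1) g = g⁻¹ := by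
    intro g; rw [hφ]; rfl
  refine ⟨φ, hφ', ?_⟩
  obtain ⟨fx, hfx⟩ := zmod_hom q x (by rw [← hx, pow_orderOf_eq_one])
  obtain ⟨fs, hfs⟩ := zmod_hom (2 ^ m) s (by rw [← hs, pow_orderOf_eq_one])
  have ix := zmod_hom_inj q fx (by rw [hfx, hx])
  have is := zmod_hom_inj (2 ^ m) fs (by rw [hfs, hs])
  have hfxx : ∀ a, ∃ k : ℕ, fx a = x ^ k := by
    intro a
    obtain ⟨k, rfl⟩ := zmod_gen q a
    exact ⟨k, by rw [map_pow, hfx]⟩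
  have hfss : ∀ a, ∃ k : ℕ, fs a = s ^ k := by
    intro a
    obtain ⟨k, rfl⟩ := zmod_gen _ a
    exact ⟨k, by rw [map_pow, hfs]⟩
  have hcompat : ∀ g, ∀ a, fx (φ g a) = fs g * fx a * (fs g)⁻¹ := by
    intro g
    obtain ⟨k, rfl⟩ := zmod_gen _ g
    induction k with
    | zero => intro a; simp
    | succ k ih =>
      intro a
      rw [pow_succ, map_mul, map_mul, MulAut.mul_apply, ih, hφ', map_inv, hfs]
      obtain ⟨j, hj⟩ := hfxx a
      rw [hj, ← conj_pow_inv s x hsx]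
      group
  let F := SemidirectProduct.lift fx fs (fun g => MonoidHom.ext fun a => hcompat g a)
  have hF : ∀ y, F y = fx y.left * fs y.right := fun y => rfl
  have hone : ∀ j : ℕ, x ^ j * x ^ j = 1 → x ^ j = 1 := by
    intro j hj
    apply pow_odd_one _ q hqo _ (by rw [pow_two, hj])
    rw [← pow_mul, mul_comm, pow_mul, ← hx, pow_orderOf_eq_one, one_pow]
  refine ⟨F, ?_, ⟨SemidirectProduct.inl (Multiplicative.ofAdd 1), by simp [F, hfx]⟩,
    ⟨SemidirectProduct.inr (Multiplicative.ofAdd 1), by simp [F, hfs]⟩, ?_⟩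
  · rw [injective_iff_map_eq_one]
    intro y hy
    rw [hF] at hy
    have h1 : fs y.right = 1 := by
      have h2 : (fs y.right) ^ q = 1 := by
        rw [eq_inv_of_mul_eq_one_right hy, inv_pow]
        obtain ⟨j, hj⟩ := hfxx y.left
        rw [hj, ← pow_mul, mul_comm, pow_mul, ← hx, pow_orderOf_eq_one, one_pow, inv_one]
      have h3 : (fs y.right) ^ (2 ^ m) = 1 := by
        obtain ⟨j, hj⟩ := hfss y.right
        rw [hj, ← pow_mul, mul_comm, pow_mul, ← hs, pow_orderOf_eq_one, one_pow]
      have h4 : Nat.Coprime q (2 ^ m) := Nat.Coprime.pow_right _ (Nat.coprime_two_right.mpr hqo)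
      have h5 := pow_gcd_eq_one.mpr ⟨h2, h3⟩
      rwa [h4.gcd_eq_one, pow_one] at h5
    rw [h1, mul_one] at hy
    have e1 := (injective_iff_map_eq_one fs).mp is _ h1
    have e2 := (injective_iff_map_eq_one fx).mp ix _ hy
    exact SemidirectProduct.ext e2 e1
  · intro y hy
    rw [hF] at hy ⊢
    obtain ⟨i, hi⟩ := hfxx y.left
    obtain ⟨j, hj⟩ := hfss y.right
    rw [hi, hj] at hy ⊢
    have h1 := hy s
    have h2 : x ^ i * s = s * x ^ i := by
      have h3 : x ^ i * s * s ^ j = s * x ^ i * s ^ j := by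
        rw [mul_assoc, ← pow_succ', pow_succ, ← mul_assoc, h1, mul_assoc]
      exact mul_right_cancel h3
    have h4 := conj_pow_inv s x hsx i
    rw [← h2, mul_inv_cancel_right] at h4
    rw [hone i (by nth_rewrite 1 [h4]; simp), one_mul]
    exact Subgroup.npow_mem_zpowers s j

theorem noncyclic_torsion_of_comm {Z : Type*} [i : Group Z] [Finite Z] (hc : ∀ a b : Z, a * b = b * a)
    (h : ¬ IsCyclic Z) :
    ∃ p : ℕ, p.Prime ∧ ∃ u v : Z, u ^ p = 1 ∧ u ≠ 1 ∧ v ^ p = 1 ∧ v ∉ Subgroup.zpowers u :=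
  @noncyclic_torsion Z { i with mul_comm := hc } _ h

theorem elem_contra {G : Type*} [Group G] [Finite G] (hna : ¬ ∀ a b : G, a * b = b * a)
    (h : MinFaithful G 3) (p : ℕ) (hp : p.Prime) (u v w : G)
    (hu : u ^ p = 1) (hv : v ^ p = 1) (hw : w ^ p = 1) (hu1 : u ≠ 1)
    (huc : u ∈ Subgroup.center G) (hvc : v ∈ Subgroup.center G) (hwc : w ∉ Subgroup.center G)
    (hvu : v ∉ Subgroup.zpowers u) : False := by
  have hfp : Fact p.Prime := ⟨hp⟩
  let P := Subgroup.closure ({u, v} : Set G)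
  let E := Subgroup.closure ({u, v, w} : Set G)
  have hcomm : ∀ a ∈ ({u, v, w} : Set G), ∀ b ∈ ({u, v, w} : Set G), a * b = b * a := by
    have h1 := fun g => (Subgroup.mem_center_iff.mp huc g)
    have h2 := fun g => (Subgroup.mem_center_iff.mp hvc g)
    intro a ha b hb
    rcases ha with rfl | rfl | rfl
    · rw [h1]
    · rw [h2]
    · rcases hb with rfl | rfl | rfl
      · rw [h1]
      · rw [h2]
      · rfl
  let _ : CommGroup E := Subgroup.closureCommGroupOfComm hcomm
  have hEc : ∀ a b : E, a * b = b * a := fun a b => mul_comm a b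
  have hEt : E ≠ ⊤ := by
    intro ht
    apply hna
    intro a b
    have := hEc ⟨a, by rw [ht]; trivial⟩ ⟨b, by rw [ht]; trivial⟩
    exact congrArg Subtype.val this
  have hEp : ∀ e : E, e ^ p = 1 := by
    rintro ⟨e, he⟩
    apply Subtype.ext
    change e ^ p = 1
    induction he using Subgroup.closure_induction with
    | mem x hx => rcases hx with rfl | rfl | rfl <;> assumption
    | one => simp
    | mul x y hx hy h1 h2 =>
      have hc : Commute x y := congrArg Subtype.val (hEc ⟨x, hx⟩ ⟨y, hy⟩)
      rw [hc.mul_pow, h1, h2, one_mul]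
    | inv x hx h1 => rw [inv_pow, h1, inv_one]
  have hPE : P ≤ E := Subgroup.closure_mono (by intro z hz; rcases hz with rfl | rfl <;> simp)
  have hEpg : IsPGroup p E := fun e => ⟨1, by rw [pow_one]; exact hEp e⟩
  have hPpg : IsPGroup p P := hEpg.to_le hPE
  obtain ⟨i, hi⟩ := IsPGroup.iff_card.mp hEpg
  obtain ⟨j, hj⟩ := IsPGroup.iff_card.mp hPpg
  have hPu : Subgroup.zpowers u < P := by
    refine lt_of_le_of_ne ?_ ?_
    · rw [Subgroup.zpowers_le]; exact Subgroup.subset_closure (by simp)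
    · intro he
      apply hvu
      rw [he]; exact Subgroup.subset_closure (by simp)
  have hPE' : P < E := by
    refine lt_of_le_of_ne hPE ?_
    intro he
    apply hwc
    have h1 : P ≤ Subgroup.center G := by
      rw [Subgroup.closure_le]
      intro z hz; rcases hz with rfl | rfl <;> assumption
    apply h1
    rw [he]; exact Subgroup.subset_closure (by simp)
  have c1 : Nat.card (Subgroup.zpowers u) < Nat.card P := by
    by_contra hcon
    exact hPu.ne (Subgroup.eq_of_le_of_card_ge hPu.le (by omega))
  have c2 : Nat.card P < Nat.card E := by
    by_contra hcon
    exact hPE'.ne (Subgroup.eq_of_le_of_card_ge hPE'.le (by omega))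
  rw [Nat.card_zpowers, orderOf_eq_prime hu hu1, hj] at c1
  rw [hi, hj] at c2
  have d1 : 1 < j := by
    rw [← Nat.pow_lt_pow_iff_right hp.one_lt]; simpa using c1
  have d2 : j < i := (Nat.pow_lt_pow_iff_right hp.one_lt).mp c2
  obtain ⟨γ, hγ⟩ := proper_emb h E hEt
  have h3 := elem_card γ hγ hEc p hp hEp
  rw [hi] at h3
  have := (Nat.pow_le_pow_iff_right hp.one_lt).mp h3
  omega

theorem assemble {G N B : Type*} [Group G] [Group N] [Group B] (h : MinFaithful G 3)
    (F : N →* G) (hF : Function.Injective F) (x s : G) (hx : x ∈ F.range) (hs : s ∈ F.range)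
    (hxs : x * s ≠ s * x)
    (hcen : ∀ y, (∀ g, F y * g = g * F y) → F y ∈ Subgroup.zpowers s)
    (F2 : B →* G) (hF2 : Function.Injective F2) (hF2c : ∀ b g, F2 b * g = g * F2 b)
    (hF2s : ∀ b, F2 b ∈ Subgroup.zpowers s → F2 b = 1)
    (u v : G) (hu' : u ∈ F.range ∨ u ∈ F2.range) (hv' : v ∈ F.range ∨ v ∈ F2.range)
    (hux : u * x = x * u) (hus : u * s = s * u)
    (hvx : v * x = x * v) (hvs : v * s = s * v) (p : ℕ) (hp : p.Prime) (hu : u ^ p = 1) (hu1 : u ≠ 1)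
    (hv : v ^ p = 1) (hvu : v ∉ Subgroup.zpowers u) : Nonempty (G ≃* N × B) := by
  let T := F.noncommCoprod F2 (fun m n => (hF2c n (F m)).symm)
  have hT : Function.Injective T := by
    refine (MonoidHom.noncommCoprod_injective F F2 _).mpr ⟨hF, hF2, ?_⟩
    rw [Subgroup.disjoint_def]
    rintro _ ⟨a, rfl⟩ ⟨b, hb⟩
    rw [← hb]
    apply hF2s
    rw [hb]
    apply hcen
    rw [← hb]
    exact hF2c b
  have hTa : ∀ y, T y = F y.1 * F2 y.2 := fun y => rfl
  have h1 : ∀ y, y ∈ F.range → y ∈ T.range := by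
    rintro _ ⟨a, rfl⟩
    exact ⟨(a, 1), by rw [hTa]; simp⟩
  have h2 : ∀ y, y ∈ F2.range → y ∈ T.range := by
    rintro _ ⟨a, rfl⟩
    exact ⟨(1, a), by rw [hTa]; simp⟩
  have hu'' : u ∈ T.range := hu'.elim (h1 u) (h2 u)
  have hv'' : v ∈ T.range := hv'.elim (h1 v) (h2 v)
  have htop : T.range = ⊤ := by
    by_contra hne
    obtain ⟨γ, hγ⟩ := proper_emb h T.range hne
    refine no_emb γ hγ ⟨x, h1 x hx⟩ ⟨s, h1 s hs⟩ ⟨u, hu''⟩ ⟨v, hv''⟩ ?_ (Subtype.ext hux)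
      (Subtype.ext hus) (Subtype.ext hvx) (Subtype.ext hvs) p hp (Subtype.ext hu) ?_ (Subtype.ext hv) ?_
    · intro hc; exact hxs (congrArg Subtype.val hc)
    · intro hc; exact hu1 (congrArg Subtype.val hc)
    · intro hc
      apply hvu
      obtain ⟨k, hk⟩ := Subgroup.mem_zpowers_iff.mp hc
      exact Subgroup.mem_zpowers_iff.mpr ⟨k, congrArg Subtype.val hk⟩
  exact ⟨(MulEquiv.ofBijective T ⟨hT, MonoidHom.range_eq_top.mp htop⟩).symm⟩

theorem zpowers_prime {G : Type*} [Group G] [Finite G] (p : ℕ) (hp : p.Prime) (u v : G)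
    (hv : v ^ p = 1) (hv1 : v ≠ 1) (hvu : v ∉ Subgroup.zpowers u) (y : G)
    (hyu : y ∈ Subgroup.zpowers u) (hyv : y ∈ Subgroup.zpowers v) : y = 1 := by
  have hfp : Fact p.Prime := ⟨hp⟩
  by_contra hy
  apply hvu
  have hov := orderOf_eq_prime hv hv1
  have hyp : y ^ p = 1 := by
    obtain ⟨k, rfl⟩ := Subgroup.mem_zpowers_iff.mp hyv
    rw [← zpow_natCast, ← zpow_mul, mul_comm, zpow_mul, zpow_natCast, hv, one_zpow]
  have h1 : Subgroup.zpowers y = Subgroup.zpowers v := by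
    apply Subgroup.eq_of_le_of_card_ge (by rwa [Subgroup.zpowers_le])
    rw [Nat.card_zpowers, Nat.card_zpowers, hov, orderOf_eq_prime hyp hy]
  have h2 : v ∈ Subgroup.zpowers y := by rw [h1]; exact Subgroup.mem_zpowers v
  exact (Subgroup.zpowers_le.mpr hyu) h2

theorem range_zmod {M : Type*} [Group M] (n : ℕ) [NeZero n] (f : Multiplicative (ZMod n) →* M) (b) :
    f b ∈ Subgroup.zpowers (f (Multiplicative.ofAdd 1)) := by
  obtain ⟨k, rfl⟩ := zmod_gen n b
  rw [map_pow]
  exact Subgroup.npow_mem_zpowers _ k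

theorem structureKS {G : Type*} [Group G] [Finite G] (hna : ¬ ∀ a b : G, a * b = b * a)
    (h : MinFaithful G 3) (hodd : Odd (Nat.card (commutator G))) (hG : ¬ Odd (Nat.card G)) :
    ∃ K S : Subgroup G, K.Normal ∧ Odd (Nat.card K) ∧ (∀ a b : K, a * b = b * a) ∧
      (∀ a b : S, a * b = b * a) ∧ IsPGroup 2 S ∧ ∀ g : G, ∃ k ∈ K, ∃ s ∈ S, g = k * s := by
  obtain ⟨k, r, hr, hcard⟩ := Nat.exists_eq_two_pow_mul_odd (n := Nat.card G) Nat.card_pos.ne'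
  let K : Subgroup G := ((powMonoidHom r : Abelianization G →* Abelianization G).comp Abelianization.of).ker
  have hKmem : ∀ g, g ∈ K ↔ g ^ r ∈ commutator G := by
    intro g
    rw [MonoidHom.mem_ker, MonoidHom.comp_apply, powMonoidHom_apply, ← map_pow]
    exact QuotientGroup.eq_one_iff _
  have hKn : K.Normal := MonoidHom.normal_ker _
  have hKodd : Odd (Nat.card K) := by
    by_contra hc
    rw [Nat.not_odd_iff_even, even_iff_two_dvd] at hc
    obtain ⟨g, hg⟩ := exists_prime_orderOf_dvd_card' 2 hc
    have h2 : (g : G) ^ r ∈ commutator G := (hKmem g).mp g.2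
    have h3 : (g : G) ^ (r * Nat.card (commutator G)) = 1 := by
      have := pow_card_eq_one' (x := (⟨_, h2⟩ : commutator G))
      rw [pow_mul]
      exact congrArg Subtype.val this
    have h4 : g ^ 2 = 1 := by rw [← hg, pow_orderOf_eq_one]
    have h5 := pow_odd_one (g : G) _ (hr.mul hodd) h3 (congrArg Subtype.val h4)
    have h6 : g = 1 := Subtype.ext h5
    rw [h6, orderOf_one] at hg
    omega
  have hKt : K ≠ ⊤ := by
    intro ht
    apply hG
    rw [← Subgroup.card_top (G := G), ← ht]
    exact hKodd
  have hKc : ∀ a b : K, a * b = b * a := by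
    obtain ⟨γ, hγ⟩ := proper_emb h K hKt
    intro a b
    apply hγ
    rw [map_mul, map_mul]
    exact odd_comm hKodd γ a b
  have hf2 : Fact (Nat.Prime 2) := ⟨Nat.prime_two⟩
  have hq : IsPGroup 2 (G ⧸ K) := by
    intro g
    obtain ⟨g, rfl⟩ := QuotientGroup.mk_surjective g
    refine ⟨k, ?_⟩
    rw [← QuotientGroup.mk_pow, QuotientGroup.eq_one_iff, hKmem, ← pow_mul, ← hcard, pow_card_eq_one']
    exact Subgroup.one_mem _
  obtain ⟨j, hj⟩ := IsPGroup.iff_card.mp hq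
  have hcG : Nat.card G = Nat.card K * 2 ^ j := by
    rw [← hj, ← Subgroup.card_mul_index K]; rfl
  let S : Sylow 2 G := default
  have hSc : Nat.card S = 2 ^ j := by
    rw [Sylow.card_eq_multiplicity, hcG]
    congr 1
    have hK2 : ¬ 2 ∣ Nat.card K := by
      rw [← even_iff_two_dvd, Nat.not_even_iff_odd]; exact hKodd
    rw [Nat.factorization_mul Nat.card_pos.ne' (by positivity)]
    simp [Nat.factorization_eq_zero_of_not_dvd hK2, Nat.prime_two.factorization_self]
  have hcompl : K.IsComplement' S := by
    apply Subgroup.isComplement'_of_coprime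
    · rw [hcG]; congr 1
    · have : Nat.card (S : Subgroup G) = 2 ^ j := hSc
      rw [this]
      exact Nat.Coprime.pow_right _ (Nat.coprime_two_right.mpr hKodd)
  refine ⟨K, S, hKn, hKodd, hKc, ?_, S.2, ?_⟩
  · intro a b
    apply Subtype.ext
    apply mul_inv_eq_one.mp
    have h1 : ((a : G) * (b : G) * ((b : G) * (a : G))⁻¹) ∈ (S : Subgroup G) := by
      exact Subgroup.mul_mem _ (Subgroup.mul_mem _ a.2 b.2) (Subgroup.inv_mem _ (Subgroup.mul_mem _ b.2 a.2))
    have h2 : ((a : G) * (b : G) * ((b : G) * (a : G))⁻¹) ∈ K := by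
      rw [hKmem]
      apply Subgroup.pow_mem
      have := Subgroup.commutator_mem_commutator (Subgroup.mem_top (a : G)) (Subgroup.mem_top (b : G))
      rw [mul_inv_rev, ← mul_assoc]
      exact this
    exact Subgroup.disjoint_def.mp hcompl.disjoint h2 h1
  · intro g
    obtain ⟨⟨a, b⟩, hab⟩ := hcompl.2 g
    exact ⟨a, a.2, b, b.2, hab.symm⟩

theorem stmt_14 (G : Type*) [Group G] [Finite G]
    (hna : ¬ ∀ a b : G, a * b = b * a) (h : MinFaithful G 3)
    (hodd : Odd (Nat.card (commutator G))) :
    Odd (Nat.card G) ∨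
    (∃ p q m : ℕ, p.Prime ∧ q.Prime ∧ Odd p ∧ Odd q ∧ p ≠ q ∧ 1 ≤ m ∧
      ∃ φ : Multiplicative (ZMod (2 ^ m)) →* MulAut (Multiplicative (ZMod q)),
        (∀ g : Multiplicative (ZMod q), φ (Multiplicative.ofAdd 1) g = g⁻¹) ∧
        Nonempty (G ≃* ((Multiplicative (ZMod q) ⋊[φ] Multiplicative (ZMod (2 ^ m))) ×
          Multiplicative (ZMod p) × Multiplicative (ZMod p)))) ∨
    (∃ p m : ℕ, p.Prime ∧ Odd p ∧ 2 ≤ m ∧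
      ∃ φ : Multiplicative (ZMod (2 ^ m)) →* MulAut (Multiplicative (ZMod p)),
        (∀ g : Multiplicative (ZMod p), φ (Multiplicative.ofAdd 1) g = g⁻¹) ∧
        Nonempty (G ≃* ((Multiplicative (ZMod p) ⋊[φ] Multiplicative (ZMod (2 ^ m))) ×
          Multiplicative (ZMod 2)))) := by
  by_cases hG : Odd (Nat.card G)
  · exact Or.inl hG
  right
  obtain ⟨K, S, hKn, hKodd, hKc, hSc, hS2, hKS⟩ := structureKS hna h hodd hG
  have hKc' : ∀ a ∈ K, ∀ b ∈ K, a * b = b * a := fun a ha b hb =>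
    congrArg Subtype.val (hKc ⟨a, ha⟩ ⟨b, hb⟩)
  obtain ⟨ρ0, hρ0⟩ := full_emb h
  let ρ : G →* Module.End ℂ (Fin 3 → ℂ) :=
    (Matrix.toLinAlgEquiv' (R := ℂ) (n := Fin 3)).toMulEquiv.toMonoidHom.comp ρ0
  have hρ : Function.Injective ρ := fun a b hab =>
    hρ0 ((Matrix.toLinAlgEquiv' (R := ℂ) (n := Fin 3)).injective hab)
  have h3 : Module.finrank ℂ (Fin 3 → ℂ) = 3 := by simp
  obtain ⟨e, he, heg⟩ := common_eig (by rw [h3]; decide) ρ K S hKc hSc hS2 hKS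
  obtain ⟨β, χ, hinj⟩ := exists_pair h3 ρ hρ e he heg
  have hncyc : ¬ IsCyclic (Subgroup.center G) := by
    intro hc
    obtain ⟨γ, hγ⟩ := twist hna hodd β χ hinj hc
    exact no_full_emb h γ hγ
  obtain ⟨p, hp, ⟨u, huc⟩, ⟨v, hvc⟩, hu, hu1, hv, hvu⟩ :=
    noncyclic_torsion_of_comm (fun a b : Subgroup.center G =>
      Subtype.ext (Subgroup.mem_center_iff.mp b.2 a)) hncyc
  replace hu : u ^ p = 1 := congrArg Subtype.val hu
  replace hv : v ^ p = 1 := congrArg Subtype.val hv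
  replace hu1 : u ≠ 1 := fun hc => hu1 (Subtype.ext hc)
  replace hvu : v ∉ Subgroup.zpowers u := by
    intro hc
    apply hvu
    obtain ⟨k, hk⟩ := Subgroup.mem_zpowers_iff.mp hc
    exact Subgroup.mem_zpowers_iff.mpr ⟨k, Subtype.ext hk⟩
  have hv1 : v ≠ 1 := by rintro rfl; exact hvu (Subgroup.one_mem _)
  have hfp : Fact p.Prime := ⟨hp⟩
  have hou := orderOf_eq_prime hu hu1
  have hov := orderOf_eq_prime hv hv1
  have hucm : ∀ g, u * g = g * u := fun g => (Subgroup.mem_center_iff.mp huc g).symm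
  have hvcm : ∀ g, v * g = g * v := fun g => (Subgroup.mem_center_iff.mp hvc g).symm
  -- noncommuting elements of `K` and `S`
  have hks : ∃ k ∈ K, ∃ s ∈ S, k * s ≠ s * k := by
    by_contra hcon
    push Not at hcon
    apply hna
    intro a b
    obtain ⟨k, hk, s, hs, rfl⟩ := hKS a
    obtain ⟨k', hk', s', hs', rfl⟩ := hKS b
    have c1 : Commute k k' := hKc' k hk k' hk'
    have c2 : Commute s s' := congrArg Subtype.val (hSc ⟨s, hs⟩ ⟨s', hs'⟩)
    have c3 : Commute k s' := hcon k hk s' hs'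
    have c4 : Commute k' s := hcon k' hk' s hs
    exact ((c1.mul_right c3).mul_left (c4.symm.mul_right c2)).eq
  obtain ⟨k, hk, s, hs, hks⟩ := hks
  obtain ⟨x0, hx0K, hx01, hsx0⟩ := inverted hodd β χ hinj K hKc' k s hk hks
  let q := (orderOf x0).minFac
  have hqp : q.Prime := Nat.minFac_prime (by rwa [Ne, orderOf_eq_one_iff])
  have hqd : q ∣ orderOf x0 := Nat.minFac_dvd _
  have hqo : Odd q := by
    have h1 : orderOf x0 ∣ Nat.card K := by
      have := orderOf_dvd_natCard (⟨x0, hx0K⟩ : K)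
      rwa [Subgroup.orderOf_mk] at this
    exact Odd.of_dvd_nat hKodd (hqd.trans h1)
  let x := x0 ^ (orderOf x0 / q)
  have hxo : orderOf x = q := orderOf_pow_orderOf_div (orderOf_pos x0).ne' hqd
  have hsx : s * x * s⁻¹ = x⁻¹ := conj_pow_inv s x0 hsx0 _
  have hx1 : x ≠ 1 := by
    intro hc
    rw [hc, orderOf_one] at hxo
    exact hqp.one_lt.ne hxo
  have hxq : x ^ q = 1 := by rw [← hxo, pow_orderOf_eq_one]
  have hxs : x * s ≠ s * x := by
    intro hc
    rw [← hc, mul_inv_cancel_right] at hsx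
    apply hx1
    apply pow_odd_one x q hqo hxq
    rw [pow_two]
    nth_rewrite 1 [hsx]
    simp
  have hf2 : Fact (Nat.Prime 2) := ⟨Nat.prime_two⟩
  obtain ⟨m, hm⟩ := IsPGroup.iff_orderOf.mp hS2 ⟨s, hs⟩
  rw [Subgroup.orderOf_mk] at hm
  have hm1 : 1 ≤ m := by
    by_contra hc
    have : m = 0 := by omega
    rw [this, pow_zero, orderOf_eq_one_iff] at hm
    rw [hm] at hxs
    simp at hxs
  obtain ⟨φ, hφ, F, hF, hxF, hsF, hcen⟩ := semi_hom x s q m hqp hqo hm1 hxo hm hsx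
  have hscn : s ∉ Subgroup.center G := fun hc => hxs (Subgroup.mem_center_iff.mp hc x)
  have hxcn : x ∉ Subgroup.center G := fun hc => hxs (Subgroup.mem_center_iff.mp hc s).symm
  rcases hp.eq_two_or_odd' with rfl | hpo
  · -- `p = 2`
    right
    have hm2 : 2 ≤ m := by
      by_contra hc
      have : m = 1 := by omega
      rw [this, pow_one] at hm
      exact elem_contra hna h 2 hp u v s hu hv (by rw [← hm, pow_orderOf_eq_one]) hu1 huc hvc hscn hvu
    refine ⟨q, m, hqp, hqo, hm2, φ, hφ, ?_⟩
    let w := s ^ (2 ^ (m - 1))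
    have hwo : orderOf w = 2 := by
      have h1 : 2 ^ (m - 1) = orderOf s / 2 := by
        rw [hm]
        obtain ⟨m', rfl⟩ := Nat.exists_eq_add_of_le' hm1
        simp [pow_succ]
      simp only [w]
      rw [h1]
      exact orderOf_pow_orderOf_div (orderOf_pos s).ne' (by rw [hm]; exact dvd_pow_self 2 (by omega))
    have hw2 : w ^ 2 = 1 := by rw [← hwo, pow_orderOf_eq_one]
    have hw1 : w ≠ 1 := by
      intro hc; rw [hc, orderOf_one] at hwo; omega
    have hws : w * s = s * w := (Commute.pow_left rfl _ : Commute (s ^ _) s).eq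
    have hs2x : Commute (s ^ 2) x := by
      have h1 : s ^ 2 * x * (s ^ 2)⁻¹ = x := by
        have : s ^ 2 * x * (s ^ 2)⁻¹ = s * (s * x * s⁻¹) * s⁻¹ := by
          rw [pow_two, mul_inv_rev]; simp only [mul_assoc]
        rw [this, hsx]
        have h2 : s * x⁻¹ * s⁻¹ = (s * x * s⁻¹)⁻¹ := by group
        rw [h2, hsx, inv_inv]
      exact mul_inv_eq_iff_eq_mul.mp h1
    have hwx : w * x = x * w := by
      obtain ⟨m', rfl⟩ := Nat.exists_eq_add_of_le' hm2
      have : w = (s ^ 2) ^ (2 ^ m') := by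
        simp only [w]
        rw [← pow_mul, ← pow_succ']
        rfl
      rw [this]
      exact (hs2x.pow_left _).eq
    -- an involution in the centre different from `w`
    have ht : ∃ t, t ^ 2 = 1 ∧ t ≠ 1 ∧ (∀ g, t * g = g * t) ∧ t ≠ w := by
      by_cases huw : u = w
      · refine ⟨v, hv, hv1, hvcm, ?_⟩
        rintro rfl
        exact hvu (huw ▸ Subgroup.mem_zpowers _)
      · exact ⟨u, hu, hu1, hucm, huw⟩
    obtain ⟨t, ht2, ht1, htc, htw⟩ := ht
    have htwz : t ∉ Subgroup.zpowers w := by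
      intro hc
      obtain ⟨i, hi⟩ := Subgroup.mem_zpowers_iff.mp hc
      rcases Int.even_or_odd' i with ⟨j, rfl | rfl⟩
      · rw [zpow_mul] at hi
        apply ht1
        rw [← hi]
        have : w ^ (2 : ℤ) = 1 := by exact_mod_cast hw2
        rw [this, one_zpow]
      · rw [zpow_add, zpow_mul] at hi
        have : w ^ (2 : ℤ) = 1 := by exact_mod_cast hw2
        rw [this, one_zpow, one_mul, zpow_one] at hi
        exact htw hi.symm
    have hts : t ∉ Subgroup.zpowers s := by
      intro hc
      apply htwz
      obtain ⟨i, hi⟩ := mem_powers_iff_mem_zpowers.mpr hc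
      simp only at hi
      rw [← hi] at ht2 ⊢
      rw [← pow_mul] at ht2
      have h1 := orderOf_dvd_of_pow_eq_one ht2
      rw [hm] at h1
      have h2 : 2 ^ (m - 1) ∣ i := by
        obtain ⟨m', rfl⟩ := Nat.exists_eq_add_of_le' hm1
        rw [pow_succ] at h1
        exact Nat.dvd_of_mul_dvd_mul_right (by norm_num) h1
      obtain ⟨c, rfl⟩ := h2
      rw [pow_mul]
      exact Subgroup.npow_mem_zpowers _ c
    obtain ⟨F2, hF2⟩ := zmod_hom 2 t ht2
    have hot := orderOf_eq_prime ht2 ht1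
    refine assemble h F hF x s hxF hsF hxs hcen F2 (zmod_hom_inj 2 F2 (by rw [hF2, hot])) ?_ ?_
      w t (Or.inl ?_) (Or.inr ⟨_, hF2⟩) hwx hws (htc x) (htc s) 2 Nat.prime_two hw2 hw1 ht2 htwz
    · intro b g
      obtain ⟨i, rfl⟩ := zmod_gen 2 b
      rw [map_pow, hF2]
      exact (Commute.pow_left (htc g) i).eq
    · intro b hb
      have h1 := range_zmod 2 F2 b
      rw [hF2] at h1
      exact zpowers_prime 2 Nat.prime_two s t ht2 ht1 hts _ hb h1
    · exact Subgroup.pow_mem _ hsF _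
  · -- `p` odd
    left
    have hpq : p ≠ q := by
      intro hc
      exact elem_contra hna h p hp u v x hu hv (by rw [hc]; exact hxq) hu1 huc hvc hxcn hvu
    refine ⟨p, q, m, hp, hqp, hpo, hqo, hpq, hm1, φ, hφ, ?_⟩
    have : NeZero p := ⟨hp.ne_zero⟩
    obtain ⟨fu, hfu⟩ := zmod_hom p u hu
    obtain ⟨fv, hfv⟩ := zmod_hom p v hv
    have hfuc : ∀ b g, fu b * g = g * fu b := by
      intro b g
      obtain ⟨i, rfl⟩ := zmod_gen p b
      rw [map_pow, hfu]
      exact (Commute.pow_left (hucm g) i).eq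
    have hfvc : ∀ b g, fv b * g = g * fv b := by
      intro b g
      obtain ⟨i, rfl⟩ := zmod_gen p b
      rw [map_pow, hfv]
      exact (Commute.pow_left (hvcm g) i).eq
    let F2 := fu.noncommCoprod fv (fun a b => hfuc a (fv b))
    have hF2i : Function.Injective F2 := by
      refine (MonoidHom.noncommCoprod_injective fu fv _).mpr ⟨zmod_hom_inj p fu (by rw [hfu, hou]), zmod_hom_inj p fv (by rw [hfv, hov]), ?_⟩
      rw [Subgroup.disjoint_def]
      rintro y ⟨a, rfl⟩ ⟨b, hb⟩
      have h1 := range_zmod p fu a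
      have h2 := range_zmod p fv b
      rw [hfu] at h1
      rw [hfv, hb] at h2
      exact zpowers_prime p hp u v hv hv1 hvu _ h1 h2
    have hF2a : ∀ b, F2 b = fu b.1 * fv b.2 := fun b => rfl
    refine assemble h F hF x s hxF hsF hxs hcen F2 hF2i ?_ ?_
      u v (Or.inr ⟨(Multiplicative.ofAdd 1, 1), by rw [hF2a]; simp [hfu]⟩)
      (Or.inr ⟨(1, Multiplicative.ofAdd 1), by rw [hF2a]; simp [hfv]⟩)
      (hucm x) (hucm s) (hvcm x) (hvcm s) p hp hu hu1 hv hvu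
    · intro b g
      rw [hF2a]
      exact (Commute.mul_left (hfuc b.1 g) (hfvc b.2 g)).eq
    · intro b hb
      have h1 : (F2 b) ^ p = 1 := by
        have hb1 : b ^ p = 1 := by
          ext <;> simp
        rw [← map_pow, hb1, map_one]
      have h2 : (F2 b) ^ (2 ^ m) = 1 := by
        obtain ⟨i, hi⟩ := Subgroup.mem_zpowers_iff.mp hb
        rw [← hi, ← zpow_natCast, ← zpow_mul, mul_comm, zpow_mul, zpow_natCast, ← hm,
          pow_orderOf_eq_one, one_zpow]
      have h4 : Nat.Coprime p (2 ^ m) := Nat.Coprime.pow_right _ (Nat.coprime_two_right.mpr hpo)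
      have h5 := pow_gcd_eq_one.mpr ⟨h1, h2⟩
      rwa [h4.gcd_eq_one, pow_one] at h5
end

section
/- Let G be a finite nonabelian 2-group that is minimally faithful of degree 3 and contains a nonabelian proper subgroup. Then G is isomorphic to Q_8 × C_2. -/
lemma exists_inv_pow {G : Type*} [Group G] (hp : IsPGroup 2 G) {g : G} (hg : g ≠ 1) :
    ∃ k : ℕ, g ^ k ≠ 1 ∧ (g ^ k) ^ 2 = 1 := by
  have : Fact (Nat.Prime 2) := ⟨Nat.prime_two⟩
  obtain ⟨m, hm⟩ := hp.dvd_orderOf hg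
  have hpos : 0 < orderOf g := (hp.isOfFinOrder (by norm_num) g).orderOf_pos
  refine ⟨m, ?_, ?_⟩
  · intro h
    have := Nat.le_of_dvd (by omega) (orderOf_dvd_of_pow_eq_one h)
    omega
  · rw [← pow_mul, mul_comm, ← hm, pow_orderOf_eq_one]

lemma exists_central_inv_in_normal {G : Type*} [Group G] [Finite G] (hp : IsPGroup 2 G)
    (N : Subgroup G) [hN : N.Normal] (hne : N ≠ ⊥) :
    ∃ z ∈ N, z ≠ 1 ∧ z ^ 2 = 1 ∧ ∀ g, z * g = g * z := by
  have : Fact (Nat.Prime 2) := ⟨Nat.prime_two⟩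
  have hp' : IsPGroup 2 (ConjAct G) := hp
  have hd : 2 ∣ Nat.card N := by
    rcases (hp.to_subgroup N).card_eq_or_dvd with h | h
    · exact absurd (Subgroup.eq_bot_of_card_eq N h) hne
    · exact h
  obtain ⟨b, hb, hb1⟩ := hp'.exists_fixed_point_of_prime_dvd_card_of_fixed_point N hd
    (a := 1) (by intro g; simp)
  have hbc : ∀ g : G, (b : G) * g = g * b := by
    intro g
    have := congrArg (Subtype.val) (hb (ConjAct.toConjAct g))
    rw [ConjAct.Subgroup.val_conj_smul, ConjAct.toConjAct_smul] at this
    exact (mul_inv_eq_iff_eq_mul.mp this).symm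
  have hb1' : (b : G) ≠ 1 := fun h => hb1 (Subtype.ext h.symm)
  obtain ⟨k, hk1, hk2⟩ := exists_inv_pow hp hb1'
  exact ⟨(b : G) ^ k, N.pow_mem b.2 k, hk1, hk2, fun g => Commute.pow_left (hbc g) k⟩

lemma mat_comm {n : ℕ} (hn : n ≤ 2) (a b : Matrix (Fin n) (Fin n) ℂ) (hab : a * b = b * a) :
    (∃ p : ℂ, a = p • 1) ∨ ∃ p q : ℂ, b = p • 1 + q • a := by
  interval_cases n
  · left; exact ⟨0, Subsingleton.elim _ _⟩
  · left; refine ⟨a 0 0, ?_⟩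
    ext i j; fin_cases i; fin_cases j; simp
  · have h00 := congrFun (congrFun hab 0) 0
    have h01 := congrFun (congrFun hab 0) 1
    have h10 := congrFun (congrFun hab 1) 0
    simp only [Matrix.mul_apply, Fin.sum_univ_two] at h00 h01 h10
    by_cases h1 : a 0 1 = 0
    · by_cases h2 : a 1 0 = 0
      · by_cases h3 : a 0 0 = a 1 1
        · left; refine ⟨a 0 0, ?_⟩
          ext i j; fin_cases i <;> fin_cases j <;> simp [h1, h2, h3]
        · right
          have h3' : a 0 0 - a 1 1 ≠ 0 := sub_ne_zero.mpr h3
          have e1 : b 0 1 = 0 := by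
            apply mul_left_cancel₀ h3'
            linear_combination h01 + (b 0 0 - b 1 1) * h1
          have e2 : b 1 0 = 0 := by
            apply mul_left_cancel₀ h3'
            linear_combination -h10 + (b 0 0 - b 1 1) * h2
          refine ⟨b 0 0 - (b 0 0 - b 1 1) / (a 0 0 - a 1 1) * a 0 0,
            (b 0 0 - b 1 1) / (a 0 0 - a 1 1), ?_⟩
          ext i j; fin_cases i <;> fin_cases j <;> simp [h1, h2, e1, e2]
          field_simp; ring
      · right
        refine ⟨b 0 0 - b 1 0 / a 1 0 * a 0 0, b 1 0 / a 1 0, ?_⟩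
        ext i j; fin_cases i <;> fin_cases j <;> simp [h2] <;> field_simp <;> grind
    · right
      refine ⟨b 0 0 - b 0 1 / a 0 1 * a 0 0, b 0 1 / a 0 1, ?_⟩
      ext i j; fin_cases i <;> fin_cases j <;> simp [h1] <;> field_simp <;> grind

/-- centralizer of a nonscalar is commutative -/
lemma scalar_of_central {n : ℕ} (hn : n ≤ 2) (a b c : Matrix (Fin n) (Fin n) ℂ)
    (hab : a * b = b * a) (hac : a * c = c * a) (hbc : b * c ≠ c * b) : ∃ p : ℂ, a = p • 1 := by
  rcases mat_comm hn a b hab with h | ⟨p, q, rfl⟩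
  · exact h
  · exact absurd (by simp [add_mul, mul_add, hac]) hbc

lemma scalar_sq {n : ℕ} (p : ℂ) (h : (p • 1 : Matrix (Fin n) (Fin n) ℂ) ^ 2 = 1) :
    (p • 1 : Matrix (Fin n) (Fin n) ℂ) = 1 ∨ (p • 1 : Matrix (Fin n) (Fin n) ℂ) = -1 := by
  rcases Nat.eq_zero_or_pos n with rfl | hn
  · left; exact Subsingleton.elim _ _
  · have := congrFun (congrFun h ⟨0, hn⟩) ⟨0, hn⟩
    rw [smul_pow, one_pow] at this
    simp at this
    rcases this with rfl | rfl
    · left; simp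
    · right; simp

/-- A nonabelian group in GL_2 has at most one central involution. -/
lemma central_inv_unique {G : Type*} [Group G] {n : ℕ} (hn : n ≤ 2) (ρ : G →* GL (Fin n) ℂ)
    (hρ : Function.Injective ρ) {b c : G} (hbc : b * c ≠ c * b) {z w : G}
    (hz : ∀ g, z * g = g * z) (hw : ∀ g, w * g = g * w) (hz2 : z ^ 2 = 1) (hw2 : w ^ 2 = 1)
    (hz1 : z ≠ 1) (hw1 : w ≠ 1) : z = w := by
  have key : ∀ z : G, (∀ g, z * g = g * z) → z ^ 2 = 1 → z ≠ 1 →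
      (ρ z : Matrix (Fin n) (Fin n) ℂ) = -1 := by
    intro z hz hz2 hz1
    have hm : ∀ g h : G, (ρ g : Matrix (Fin n) (Fin n) ℂ) * ρ h = ρ (g * h) := by
      intro g h; simp
    obtain ⟨p, hp⟩ := scalar_of_central hn (ρ z) (ρ b) (ρ c) (by rw [hm, hm, hz])
      (by rw [hm, hm, hz])
      (by rw [hm, hm]; intro h; exact hbc (hρ (Units.ext h)))
    have h2 : (ρ z : Matrix (Fin n) (Fin n) ℂ) ^ 2 = 1 := by
      rw [← Units.val_pow_eq_pow_val, ← map_pow, hz2]; simp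
    rcases scalar_sq p (hp ▸ h2) with h | h
    · exact absurd (hρ (Units.ext (by rw [hp, h]; simp))) hz1
    · rw [hp, h]
  exact hρ (Units.ext (by rw [key z hz hz2 hz1, key w hw hw2 hw1]))

/-- no three independent commuting involutions in GL_2 -/
lemma no_three {G : Type*} [Group G] {n : ℕ} (hn : n ≤ 2) (ρ : G →* GL (Fin n) ℂ)
    (hρ : Function.Injective ρ) {a b c : G} (hab : a * b = b * a) (hac : a * c = c * a)
    (hbc : b * c = c * b)
    (ha2 : a ^ 2 = 1) (hb2 : b ^ 2 = 1) (hc2 : c ^ 2 = 1) (ha : a ≠ 1) (hb : b ≠ 1) (hc : c ≠ 1)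
    (h1 : a ≠ b) (h2 : a ≠ c) (h3 : b ≠ c) (h4 : a * b ≠ c) : False := by
  let f : G → Matrix (Fin n) (Fin n) ℂ := fun g => ρ g
  have hf : Function.Injective f := fun x y h => hρ (Units.ext h)
  have hm : ∀ g h : G, f (g * h) = f g * f h := by intro g h; simp [f]
  have hone : f 1 = 1 := by simp [f]
  have hsq : ∀ g, g ^ 2 = 1 → f g ^ 2 = 1 := by
    intro g hg; rw [pow_two, ← hm, ← pow_two, hg, hone]
  have dich : ∀ x y : G, x * y = y * x → x ^ 2 = 1 → y ^ 2 = 1 → x ≠ 1 → y ≠ 1 → x ≠ y →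
      f x = -1 ∨ f y = -1 ∨ f y = - f x := by
    intro x y hxy hx2 hy2 hx hy hne
    have hx2' := hsq x hx2
    have hy2' := hsq y hy2
    rcases mat_comm hn (f x) (f y) (by rw [← hm, ← hm, hxy]) with ⟨p, hp⟩ | ⟨p, q, hpq⟩
    · rcases scalar_sq p (hp ▸ hx2') with h | h
      · exact absurd (hf (by rw [hp, h, hone])) hx
      · left; rw [hp, h]
    · have e : f y ^ 2 = (p ^ 2 + q ^ 2) • 1 + (2 * p * q) • f x := by
        rw [hpq, pow_two, add_mul, mul_add, mul_add]
        have s : f x * f x = 1 := by rw [← pow_two, hx2']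
        simp only [smul_mul_smul_comm, mul_one, one_mul, s]
        module
      by_cases h0 : p * q = 0
      · rcases mul_eq_zero.mp h0 with h0 | h0
        · rw [h0, zero_smul, zero_add] at hpq
          have : (q • 1 : Matrix (Fin n) (Fin n) ℂ) ^ 2 = 1 := by
            rw [smul_pow, one_pow]
            rw [hpq, smul_pow, hx2'] at hy2'
            exact hy2'
          rcases scalar_sq q this with h | h
          · exact absurd (hf (by rw [hpq, ← one_mul (f x), ← smul_mul_assoc, h])) hne
          · right; right; rw [hpq]
            rw [← one_mul (f x), ← smul_mul_assoc, h]; simp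
        · rw [h0, zero_smul, add_zero] at hpq
          rcases scalar_sq p (hpq ▸ hy2') with h | h
          · exact absurd (hf (by rw [hpq, h, hone])) hy
          · right; left; rw [hpq, h]
      · have hx' : f x = ((2 * p * q)⁻¹ * (1 - (p ^ 2 + q ^ 2))) • 1 := by
          have hn0 : (2 * p * q) ≠ 0 := by
            rw [mul_assoc]; exact mul_ne_zero two_ne_zero h0
          have : (2 * p * q) • f x = (1 - (p ^ 2 + q ^ 2)) • 1 := by
            rw [hy2'] at e
            rw [sub_smul, one_smul, eq_sub_iff_add_eq, add_comm]; exact e.symm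
          rw [mul_smul, ← this, smul_smul, inv_mul_cancel₀ hn0, one_smul]
        rcases scalar_sq _ (hx' ▸ hx2') with h | h
        · exact absurd (hf (by rw [hx', h, hone])) hx
        · left; rw [hx', h]
  have d1 := dich a b hab ha2 hb2 ha hb h1
  have d2 := dich a c hac ha2 hc2 ha hc h2
  have d3 := dich b c hbc hb2 hc2 hb hc h3
  have e1 : f a ≠ f b := fun h => h1 (hf h)
  have e2 : f a ≠ f c := fun h => h2 (hf h)
  have e3 : f b ≠ f c := fun h => h3 (hf h)
  have e4 : f a * f b ≠ f c := fun h => h4 (hf (by rw [hm, h]))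
  have s1 := hsq a ha2
  rw [pow_two] at s1
  rcases d1 with h | h | h <;> rcases d2 with h' | h' | h' <;> rcases d3 with h'' | h'' | h'' <;>
    simp_all

/-- A nonabelian 2-group in GL_3 with no faithful representation of degree at most 2 has at
least two central involutions. -/
lemma two_central {G : Type*} [Group G] [Finite G] (hp : IsPGroup 2 G)
    {b c : G} (hbc : b * c ≠ c * b) (ρ : G →* GL (Fin 3) ℂ) (hρ : Function.Injective ρ)
    (hmin : ∀ n ≤ 2, ∀ σ : G →* GL (Fin n) ℂ, ¬ Function.Injective σ) (w : G) :
    ∃ z : G, z ≠ w ∧ z ≠ 1 ∧ z ^ 2 = 1 ∧ ∀ g, z * g = g * z := by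
  by_contra hcon
  push Not at hcon
  have hN : ∀ N : Subgroup G, N.Normal → w ∉ N → N = ⊥ := by
    intro N hN hw
    by_contra hne
    obtain ⟨z, hz, hz1, hz2, hzc⟩ := exists_central_inv_in_normal hp N hne
    have hzw : z ≠ w := fun h => hw (h ▸ hz)
    obtain ⟨g, hg⟩ := hcon z hzw hz1 hz2
    exact hg (hzc g)
  have hnb : (⊤ : Subgroup G) ≠ ⊥ := by
    intro h
    have : ∀ g : G, g = 1 := fun g => Subgroup.mem_bot.mp (h ▸ Subgroup.mem_top g)
    exact hbc (by rw [this b, this c])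
  obtain ⟨z, -, hz1, hz2, hzc⟩ := exists_central_inv_in_normal hp ⊤ hnb
  have hzw : z = w := by
    by_contra hzw
    obtain ⟨g, hg⟩ := hcon z hzw hz1 hz2
    exact hg (hzc g)
  subst hzw
  by_cases hm : (ρ z : Matrix (Fin 3) (Fin 3) ℂ) = -1
  · -- use determinant
    let d : G →* ℂˣ := Matrix.GeneralLinearGroup.det.comp ρ
    have hd : z ∉ d.ker := by
      rw [MonoidHom.mem_ker]
      intro h
      have h' := congrArg Units.val h
      simp only [d, MonoidHom.comp_apply, Matrix.GeneralLinearGroup.val_det_apply, hm,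
        Units.val_one] at h'
      rw [Matrix.det_neg] at h'
      norm_num at h'
    have hk := hN d.ker inferInstance hd
    have hinj := (MonoidHom.ker_eq_bot_iff d).mp hk
    exact hbc (hinj (by rw [map_mul, map_mul, mul_comm]))
  · let r : Representation ℂ G (Fin 3 → ℂ) :=
      (Matrix.toLinAlgEquiv' (R := ℂ) (n := Fin 3) : _ →* _).comp
        ((Units.coeHom _).comp ρ)
    have hr : ∀ g v, r g v = (ρ g : Matrix (Fin 3) (Fin 3) ℂ).mulVec v := by
      intro g v
      simp [r]
    let E : Submodule ℂ (Fin 3 → ℂ) := LinearMap.ker (r z + 1)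
    have hE : ∀ v, v ∈ E ↔ r z v = -v := by
      intro v
      simp [E, LinearMap.mem_ker, eq_neg_iff_add_eq_zero]
    have hle : ∀ g, E ≤ E.comap (r g) := by
      intro g v hv
      rw [hE] at hv
      rw [Submodule.mem_comap, hE]
      have : r z (r g v) = r g (r z v) := by
        rw [← Module.End.mul_apply, ← Module.End.mul_apply, ← map_mul, ← map_mul, hzc]
      rw [this, hv, map_neg]
    have hEtop : E ≠ ⊤ := by
      intro h
      apply hm
      apply Matrix.toLin'.injective
      ext1 i
      ext1
      have := (hE (Pi.single i 1)).mp (h ▸ Submodule.mem_top)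
      rw [hr] at this
      simp only [LinearMap.comp_apply, Matrix.toLin'_apply, LinearMap.single_apply]
      rw [this]
      simp only [Matrix.neg_mulVec, Matrix.one_mulVec]
    have hdim : Module.finrank ℂ E ≤ 2 := by
      have := Submodule.finrank_lt hEtop
      simp at this
      omega
    let s := r.subrepresentation E hle
    let B := Module.finBasis ℂ E
    let σ0 : G →* Matrix (Fin (Module.finrank ℂ E)) (Fin (Module.finrank ℂ E)) ℂ :=
      (LinearMap.toMatrixAlgEquiv B : _ →* _).comp s
    apply hmin _ hdim σ0.toHomUnits
    rw [← MonoidHom.ker_eq_bot_iff]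
    apply hN _ inferInstance
    rw [MonoidHom.ker_toHomUnits, MonoidHom.mem_ker]
    intro h
    have hs : s z = 1 := by
      apply (LinearMap.toMatrixAlgEquiv B).injective
      rw [map_one]; exact h
    have hE0 : ∀ v ∈ E, v = 0 := by
      intro v hv
      have h1 := congrArg Subtype.val (LinearMap.congr_fun hs ⟨v, hv⟩)
      have h2 : r z v = v := h1
      rw [(hE v).mp hv] at h2
      exact neg_eq_self.mp h2
    apply hz1
    apply hρ
    rw [map_one]
    apply Units.ext
    apply Matrix.toLin'.injective
    apply LinearMap.ext
    intro v
    have hv : r z v - v ∈ E := by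
      rw [hE, map_sub, ← Module.End.mul_apply, ← map_mul, ← pow_two, hz2, map_one,
        Module.End.one_apply, neg_sub]
    have := hE0 _ hv
    rw [sub_eq_zero, hr] at this
    simpa using this

lemma quat_relations {H : Type*} [Group H] [Finite H] (hp : IsPGroup 2 H)
    (hna : ∃ a b : H, a * b ≠ b * a)
    (hab : ∀ K : Subgroup H, K ≠ ⊤ → ∀ a ∈ K, ∀ b ∈ K, a * b = b * a)
    (w : H) (hw1 : w ≠ 1) (hw2 : w ^ 2 = 1) (hwc : ∀ g, w * g = g * w)
    (hinv : ∀ a : H, a ^ 2 = 1 → a ≠ 1 → a = w) :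
    ∃ x y : H, x * y ≠ y * x ∧ x ^ 2 = w ∧ y ^ 2 = w ∧ y * x = x * y * w := by
  have : Fact (Nat.Prime 2) := ⟨Nat.prime_two⟩
  obtain ⟨x, y, hxy⟩ := hna
  have hsqc : ∀ g h : H, g ^ 2 * h = h * g ^ 2 := by
    intro g h
    obtain ⟨N, hN⟩ := IsPGroup.iff_card.mp hp
    obtain ⟨k, hk⟩ := IsPGroup.iff_card.mp (hp.to_subgroup (Subgroup.zpowers h))
    have hzt : Subgroup.zpowers h ≠ ⊤ := by
      intro ht
      apply hxy
      have hx : x ∈ Subgroup.zpowers h := ht ▸ Subgroup.mem_top x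
      have hy : y ∈ Subgroup.zpowers h := ht ▸ Subgroup.mem_top y
      obtain ⟨i, rfl⟩ := hx
      obtain ⟨j, rfl⟩ := hy
      exact (Commute.refl h).zpow_zpow i j
    have hlt : k < N := by
      by_contra hle
      apply hzt
      apply Subgroup.eq_top_of_le_card
      rw [hN, hk]
      exact Nat.pow_le_pow_right (by norm_num) (by omega)
    obtain ⟨M, hM, hMle⟩ := Sylow.exists_subgroup_card_pow_prime_le 2
      (n := k) (m := N - 1) (by rw [hN]; exact pow_dvd_pow 2 (by omega)) _ hk (by omega)
    have hidx : M.index = 2 := by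
      have := M.card_mul_index
      rw [hM, hN] at this
      obtain ⟨N', rfl⟩ : ∃ N', N = N' + 1 := ⟨N - 1, by omega⟩
      rw [pow_succ] at this
      exact Nat.eq_of_mul_eq_mul_left (by positivity) this
    apply hab M
    · rintro rfl
      simp at hidx
    · exact Subgroup.sq_mem_of_index_two hidx g
    · exact hMle (Subgroup.mem_zpowers h)
  have hsqZ : ∀ g : H, g ^ 2 ∈ Subgroup.center H := by
    intro g
    rw [Subgroup.mem_center_iff]
    intro h
    exact (hsqc g h).symm
  have hcomm : y * x = x * y * w := by
    have h1 : (x * y)⁻¹ * (y * x) = w := by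
      obtain ⟨c, hc⟩ : ∃ c, c = (x * y)⁻¹ * (y * x) := ⟨_, rfl⟩
      have hcZ : c ∈ Subgroup.center H := by
        have e : c = (y ^ 2)⁻¹ * (y * x⁻¹) ^ 2 * x ^ 2 := by
          rw [hc, pow_two, pow_two, pow_two]; group
        rw [e]
        exact mul_mem (mul_mem (inv_mem (hsqZ y)) (hsqZ _)) (hsqZ x)
      have hcc := Subgroup.mem_center_iff.mp hcZ
      rw [← hc]
      apply hinv
      · have e1 : y⁻¹ * x⁻¹ * y = c * x⁻¹ := by rw [hc]; group
        have e2 : (y⁻¹ * x⁻¹ * y) * (y⁻¹ * x⁻¹ * y) = x⁻¹ ^ 2 := by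
          have : (y⁻¹ * x⁻¹ * y) * (y⁻¹ * x⁻¹ * y) = y⁻¹ * (x⁻¹ ^ 2 * y) := by
            rw [pow_two]; group
          rw [this, hsqc]; group
        have e3 : (c * x⁻¹) * (c * x⁻¹) = c ^ 2 * x⁻¹ ^ 2 := by
          rw [mul_assoc, ← mul_assoc x⁻¹, hcc x⁻¹, pow_two, pow_two]; group
        rw [e1, e3] at e2
        exact mul_eq_right.mp e2
      · intro h
        exact hxy (inv_mul_eq_one.mp (hc ▸ h))
    rw [← h1]; group
  have hwZ : w ∈ Subgroup.center H := Subgroup.mem_center_iff.mpr fun g => (hwc g).symm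
  have hinv' : ∀ a : H, a ^ 2 = 1 → a ∈ Subgroup.center H := by
    intro a ha
    by_cases h : a = 1
    · rw [h]; exact one_mem _
    · rw [hinv a ha h]; exact hwZ
  have hxZ : x ∉ Subgroup.center H := fun h => hxy (Subgroup.mem_center_iff.mp h y).symm
  have hyZ : y ∉ Subgroup.center H := fun h => hxy (Subgroup.mem_center_iff.mp h x)
  have hxyZ : x * y ∉ Subgroup.center H := by
    intro h
    have := Subgroup.mem_center_iff.mp h x
    rw [mul_assoc] at this
    exact hxy (mul_left_cancel this)
  let f : Subgroup.center H →* Subgroup.center H :=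
    { toFun := fun t => t ^ 2
      map_one' := one_pow 2
      map_mul' := fun a b => Commute.mul_pow
        (Subtype.ext (Subgroup.mem_center_iff.mp b.2 a)) 2 }
  have hidx : f.range.index = 2 := by
    have h1 := f.range.card_mul_index
    have h2 := f.ker.card_mul_index
    rw [Subgroup.index_ker] at h2
    have h3 : Nat.card f.ker = 2 := by
      rw [Nat.card_eq_two_iff]
      refine ⟨1, ⟨⟨w, hwZ⟩, ?_⟩, ?_, ?_⟩
      · rw [MonoidHom.mem_ker]; exact Subtype.ext hw2
      · intro h
        have h' := congrArg Subtype.val (congrArg Subtype.val h)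
        exact hw1 h'.symm
      · ext ⟨⟨t, ht⟩, htk⟩
        simp only [Set.mem_insert_iff, Set.mem_singleton_iff, Set.mem_univ, iff_true]
        by_cases h : t = 1
        · left; subst h; rfl
        · right
          have : t = w := hinv t (congrArg Subtype.val (MonoidHom.mem_ker.mp htk)) h
          subst this; rfl
    rw [h3, ← h1, mul_comm] at h2
    exact (Nat.eq_of_mul_eq_mul_left Nat.card_pos h2).symm
  have hnr : ∀ g : H, g ∉ Subgroup.center H → (⟨g ^ 2, hsqZ g⟩ : Subgroup.center H) ∉ f.range := by
    rintro g hg ⟨⟨t, ht⟩, htg⟩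
    have htg' : t ^ 2 = g ^ 2 := congrArg Subtype.val htg
    apply hg
    have htc := Subgroup.mem_center_iff.mp ht
    have h1 : (g * t⁻¹) ^ 2 = 1 := by
      have : Commute g t⁻¹ := Commute.inv_right (htc g)
      rw [this.mul_pow, inv_pow, htg', mul_inv_cancel]
    have := mul_mem (hinv' _ h1) ht
    simpa using this
  have hxy2 : (x * y) ^ 2 = x ^ 2 * y ^ 2 * w := by
    calc (x * y) ^ 2 = x * (y * x) * y := by rw [pow_two]; group
      _ = x ^ 2 * y * (w * y) := by rw [hcomm, pow_two]; group
      _ = _ := by rw [hwc, pow_two y]; group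
  have hwr : (⟨w, hwZ⟩ : Subgroup.center H) ∉ f.range := by
    intro hw
    have h1 := hnr _ hxyZ
    apply h1
    have : (⟨(x * y) ^ 2, hsqZ _⟩ : Subgroup.center H) =
      (⟨x ^ 2, hsqZ x⟩ * ⟨y ^ 2, hsqZ y⟩) * ⟨w, hwZ⟩ := Subtype.ext hxy2
    rw [this]
    refine mul_mem ?_ hw
    rw [Subgroup.mul_mem_iff_of_index_two hidx]
    exact iff_of_false (hnr x hxZ) (hnr y hyZ)
  have hZ : ∀ t ∈ Subgroup.center H, t ^ 2 = 1 := by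
    intro t ht
    by_contra h
    obtain ⟨k, hk1, hk2⟩ := exists_inv_pow hp h
    apply hwr
    refine ⟨⟨t ^ k, pow_mem ht k⟩, Subtype.ext ?_⟩
    change (t ^ k) ^ 2 = w
    rw [← hinv _ hk2 hk1, ← pow_mul, ← pow_mul, mul_comm]
  have hfin : ∀ g : H, g ∉ Subgroup.center H → g ^ 2 = w := by
    intro g hg
    exact hinv _ (hZ _ (hsqZ g)) fun h => hg (hinv' g h)
  exact ⟨x, y, hxy, hfin x hxZ, hfin y hyZ, hcomm⟩

lemma exists_q8_hom {G : Type*} [Group G] {x y : G} (hxy : x * y ≠ y * x) (hx2 : x ^ 2 ≠ 1)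
    (hx4 : x ^ 4 = 1) (hy2 : y ^ 2 = x ^ 2) (hr : y * x⁻¹ = x * y) :
    ∃ f : QuaternionGroup 2 →* G, Function.Injective f ∧
      f (QuaternionGroup.a 1) = x ∧ f (QuaternionGroup.xa 0) = y := by
  let φ : ZMod (2 * 2) → G := fun i => x ^ i.val
  have hφ : ∀ i j, φ (i + j) = φ i * φ j := by
    intro i j
    simp only [φ]
    rw [ZMod.val_add, ← pow_add]
    exact (pow_eq_pow_mod _ hx4).symm
  have hφ0 : φ 0 = 1 := by simp [φ]
  have hφn : ∀ i, φ (-i) = (φ i)⁻¹ := by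
    intro i
    rw [eq_inv_iff_mul_eq_one, ← hφ, neg_add_cancel, hφ0]
  have hφs : ∀ i j, φ (i - j) = φ i * (φ j)⁻¹ := by
    intro i j
    rw [sub_eq_add_neg, hφ, hφn]
  have hφc : ∀ i j, φ i * φ j = φ j * φ i := by
    intro i j
    rw [← hφ, ← hφ, add_comm]
  have hφy : ∀ i, φ i * y = y * (φ i)⁻¹ := by
    intro i
    have h : SemiconjBy y x⁻¹ x := hr
    have := h.pow_right i.val
    rw [inv_pow] at this
    exact this.symm
  have hφ1 : φ 1 = x := by
    have : (1 : ZMod (2 * 2)).val = 1 := rfl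
    simp only [φ, this, pow_one]
  have hφ2 : φ (2 : ℕ) = y * y := by
    have : ((2 : ℕ) : ZMod (2 * 2)).val = 2 := rfl
    simp only [φ, this]
    rw [← hy2, pow_two]
  let f : QuaternionGroup 2 →* G :=
    { toFun := fun q => match q with
        | .a i => φ i
        | .xa i => y * φ i
      map_one' := hφ0
      map_mul' := by
        rintro (i | i) (j | j)
        · exact hφ i j
        · change y * φ (j - i) = φ i * (y * φ j)
          rw [hφs, ← mul_assoc, ← mul_assoc, hφy, mul_assoc, mul_assoc, ← hφn, hφc]
        · change y * φ (i + j) = y * φ i * φ j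
          rw [hφ, mul_assoc]
        · change φ ((2 : ℕ) + j - i) = y * φ i * (y * φ j)
          have : y * φ i * (y * φ j) = y * (φ i * y) * φ j := by group
          rw [this, hφy, hφs, hφ, hφ2, ← hφn, mul_assoc, hφc j]
          group }
  refine ⟨f, ?_, hφ1, ?_⟩
  · rw [injective_iff_map_eq_one]
    rintro (i | i) hi
    · change x ^ i.val = 1 at hi
      have hlt : i.val < 4 := ZMod.val_lt i
      have h0 : i.val = 0 := by
        have hx1 : x ≠ 1 := fun h => hxy (by rw [h]; simp)
        generalize i.val = k at *
        interval_cases k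
        · rfl
        · exact absurd (by simpa using hi) hx1
        · exact absurd hi hx2
        · rw [pow_succ, hi, one_mul] at hx4
          exact absurd hx4 hx1
      rw [(ZMod.val_eq_zero i).mp h0]
      rfl
    · change y * x ^ i.val = 1 at hi
      have : y = (x ^ i.val)⁻¹ := eq_inv_of_mul_eq_one_left hi
      exfalso
      apply hxy
      rw [this]
      exact ((Commute.refl x).pow_right i.val).inv_right
  · change y * φ 0 = y
    rw [hφ0, mul_one]

theorem stmt_16 (G : Type*) [Group G] [Finite G] (hp : IsPGroup 2 G)
    (hna : ¬ ∀ a b : G, a * b = b * a) (h : MinFaithful G 3)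
    (hsub : ∃ H : Subgroup G, H ≠ ⊤ ∧ ¬ ∀ a b : H, a * b = b * a) :
    Nonempty (G ≃* (QuaternionGroup 2 × Multiplicative (ZMod 2))) := by
  obtain ⟨h3, hprop⟩ := h
  have hne : {n : ℕ | ∃ ρ : G →* GL (Fin n) ℂ, Function.Injective ρ}.Nonempty := by
    apply Nat.nonempty_of_pos_sInf
    change 0 < rdim G
    omega
  obtain ⟨ρ, hρ⟩ : ∃ ρ : G →* GL (Fin 3) ℂ, Function.Injective ρ := by
    have := Nat.sInf_mem hne
    change rdim G ∈ _ at this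
    rw [h3] at this
    exact this
  have hmin : ∀ n ≤ 2, ∀ σ : G →* GL (Fin n) ℂ, ¬ Function.Injective σ := by
    intro n hn σ hσ
    have : rdim G ≤ n := Nat.sInf_le ⟨σ, hσ⟩
    omega
  have hK : ∀ K : Subgroup G, K ≠ ⊤ → ∃ n ≤ 2, ∃ σ : K →* GL (Fin n) ℂ, Function.Injective σ := by
    intro K hK
    have hne' : {n : ℕ | ∃ ρ : K →* GL (Fin n) ℂ, Function.Injective ρ}.Nonempty :=
      ⟨3, ρ.comp K.subtype, hρ.comp K.subtype_injective⟩
    have hlt := hprop K hK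
    exact ⟨rdim K, by omega, Nat.sInf_mem hne'⟩
  push Not at hna hsub
  obtain ⟨b, c, hbc⟩ := hna
  obtain ⟨H, hHtop, ⟨b', hb'⟩, ⟨c', hc'⟩, hbc'⟩ := hsub
  have hbc'' : b' * c' ≠ c' * b' := fun h => hbc' (Subtype.ext h)
  have hA : ∀ K : Subgroup G, K ≠ ⊤ → ∀ b ∈ K, ∀ c ∈ K, b * c ≠ c * b → ∀ z ∈ K, ∀ w ∈ K,
      (∀ g ∈ K, z * g = g * z) → (∀ g ∈ K, w * g = g * w) → z ^ 2 = 1 → w ^ 2 = 1 → z ≠ 1 →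
      w ≠ 1 → z = w := by
    intro K hKt b hb c hc hbc z hz w hw hzc hwc hz2 hw2 hz1 hw1
    obtain ⟨n, hn, σ, hσ⟩ := hK K hKt
    have := central_inv_unique hn σ hσ (b := ⟨b, hb⟩) (c := ⟨c, hc⟩)
      (fun h => hbc (congrArg Subtype.val h)) (z := ⟨z, hz⟩) (w := ⟨w, hw⟩)
      (fun g => Subtype.ext (hzc g g.2)) (fun g => Subtype.ext (hwc g g.2))
      (Subtype.ext hz2) (Subtype.ext hw2) (fun h => hz1 (congrArg Subtype.val h))
      (fun h => hw1 (congrArg Subtype.val h))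
    exact congrArg Subtype.val this
  obtain ⟨z, hzH, hz1, hz2, hzc⟩ : ∃ z : G, z ∉ H ∧ z ≠ 1 ∧ z ^ 2 = 1 ∧ ∀ g, z * g = g * z := by
    obtain ⟨z, -, hz1, hz2, hzc⟩ := two_central hp hbc ρ hρ hmin 1
    obtain ⟨w, hwz, hw1, hw2, hwc⟩ := two_central hp hbc ρ hρ hmin z
    by_cases hz : z ∈ H
    · by_cases hw : w ∈ H
      · exact absurd (hA H hHtop b' hb' c' hc' hbc'' w hw z hz (fun g _ => hwc g)
          (fun g _ => hzc g) hw2 hz2 hw1 hz1) hwz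
      · exact ⟨w, hw, hw1, hw2, hwc⟩
    · exact ⟨z, hz, hz1, hz2, hzc⟩
  have hcen : ∀ K : Subgroup G, ∀ b ∈ K, ∀ c ∈ K, b * c ≠ c * b →
      ∃ w ∈ K, w ≠ 1 ∧ w ^ 2 = 1 ∧ ∀ g ∈ K, w * g = g * w := by
    intro K b hb c hc hbc
    have hnb : (⊤ : Subgroup K) ≠ ⊥ := by
      intro h
      have : ∀ g : K, g = 1 := fun g => Subgroup.mem_bot.mp (h ▸ Subgroup.mem_top g)
      have hb1 : b = 1 := congrArg Subtype.val (this ⟨b, hb⟩)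
      exact hbc (by rw [hb1]; simp)
    obtain ⟨w, -, hw1, hw2, hwc⟩ := exists_central_inv_in_normal (hp.to_subgroup K) ⊤ hnb
    exact ⟨w, w.2, fun h => hw1 (Subtype.ext h), congrArg Subtype.val hw2,
      fun g hg => congrArg Subtype.val (hwc ⟨g, hg⟩)⟩
  have hzz : z * z = 1 := by rw [← pow_two, hz2]
  have hB : ∀ K : Subgroup G, z ∉ K → ∀ b ∈ K, ∀ c ∈ K, b * c ≠ c * b →
      ∀ g : G, g ∈ K ∨ g * z ∈ K := by
    intro K hzK b hb c hc hbc
    let S : Subgroup G :=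
      { carrier := {g | g ∈ K ∨ g * z ∈ K}
        one_mem' := Or.inl K.one_mem
        mul_mem' := by
          rintro g k (hg | hg) (hk | hk)
          · exact Or.inl (mul_mem hg hk)
          · right; rw [mul_assoc]; exact mul_mem hg hk
          · right
            have := mul_mem hg hk
            rwa [mul_assoc, hzc, ← mul_assoc] at this
          · left
            have := mul_mem hg hk
            have e : g * z * (k * z) = g * k := by
              rw [← hzc k, mul_assoc, ← mul_assoc z z, hzz, one_mul]
            rwa [e] at this
        inv_mem' := by
          rintro g (hg | hg)
          · exact Or.inl (inv_mem hg)
          · right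
            have := inv_mem hg
            rw [mul_inv_rev, inv_eq_of_mul_eq_one_left hzz, hzc] at this
            exact this }
    have hKS : ∀ g ∈ K, g ∈ S := fun g hg => Or.inl hg
    have hSt : S = ⊤ := by
      by_contra hSt
      obtain ⟨w, hwK, hw1, hw2, hwc⟩ := hcen K b hb c hc hbc
      have hzS : z ∈ S := by
        right; rw [hzz]; exact K.one_mem
      have hwS : ∀ g ∈ S, w * g = g * w := by
        rintro g (hg | hg)
        · exact hwc g hg
        · have := hwc _ hg
          rw [← mul_assoc, mul_assoc g, hzc, ← mul_assoc] at this
          exact mul_right_cancel this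
      have := hA S hSt b (hKS b hb) c (hKS c hc) hbc z hzS w (hKS w hwK) (fun g _ => hzc g) hwS
        hz2 hw2 hz1 hw1
      exact hzK (this ▸ hwK)
    intro g
    have : g ∈ S := hSt ▸ Subgroup.mem_top g
    exact this
  have hC : ∀ K : Subgroup G, K ≤ H → ∀ b ∈ K, ∀ c ∈ K, b * c ≠ c * b → ∀ g ∈ H, g ∈ K := by
    intro K hKH b hb c hc hbc g hg
    rcases hB K (fun h => hzH (hKH h)) b hb c hc hbc g with h | h
    · exact h
    · exfalso
      apply hzH
      have := mul_mem (inv_mem hg) (hKH h)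
      rwa [inv_mul_cancel_left] at this
  obtain ⟨w, hwH, hw1, hw2, hwc⟩ := hcen H b' hb' c' hc' hbc''
  have hinv : ∀ a ∈ H, a ^ 2 = 1 → a ≠ 1 → a = w := by
    intro a ha ha2 ha1
    by_contra haw
    let T := Subgroup.centralizer {a}
    have hT : ∀ g, g * a = a * g → g ∈ T := fun g hg =>
      Subgroup.mem_centralizer_singleton_iff.mpr hg
    by_cases hTt : T = ⊤
    · apply haw
      refine hA H hHtop b' hb' c' hc' hbc'' a ha w hwH ?_ hwc ha2 hw2 ha1 hw1
      intro g _
      have : g ∈ T := hTt ▸ Subgroup.mem_top g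
      exact (Subgroup.mem_centralizer_singleton_iff.mp this).symm
    · obtain ⟨n, hn, σ, hσ⟩ := hK T hTt
      refine no_three hn σ hσ (a := ⟨a, hT a rfl⟩) (b := ⟨w, hT w (hwc a ha)⟩)
        (c := ⟨z, hT z (hzc a)⟩) (Subtype.ext (hwc a ha).symm) (Subtype.ext (hzc a).symm)
        (Subtype.ext (hzc w).symm) (Subtype.ext ha2) (Subtype.ext hw2) (Subtype.ext hz2)
        ?_ ?_ ?_ ?_ ?_ ?_ ?_
      · exact fun h => ha1 (congrArg Subtype.val h)
      · exact fun h => hw1 (congrArg Subtype.val h)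
      · exact fun h => hz1 (congrArg Subtype.val h)
      · exact fun h => haw (congrArg Subtype.val h)
      · intro h
        have h' : a = z := congrArg Subtype.val h
        exact hzH (h' ▸ ha)
      · intro h
        have h' : w = z := congrArg Subtype.val h
        exact hzH (h' ▸ hwH)
      · intro h
        have h' : a * w = z := congrArg Subtype.val h
        exact hzH (h' ▸ mul_mem ha hwH)
  obtain ⟨⟨x, hxH⟩, ⟨y, hyH⟩, hxy', hx2', hy2', hr'⟩ := quat_relations (hp.to_subgroup H)
    ⟨⟨b', hb'⟩, ⟨c', hc'⟩, hbc'⟩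
    (by
      intro K hKt a ha b hb
      by_contra hab
      apply hKt
      rw [eq_top_iff]
      rintro ⟨g, hg⟩ -
      have := hC (K.map H.subtype) (Subgroup.map_subtype_le K) a ⟨a, ha, rfl⟩ b ⟨b, hb, rfl⟩
        (fun h => hab (Subtype.ext h)) g hg
      obtain ⟨k, hk, hkg⟩ := this
      have : k = ⟨g, hg⟩ := Subtype.ext hkg
      exact this ▸ hk)
    ⟨w, hwH⟩ (fun h => hw1 (congrArg Subtype.val h)) (Subtype.ext hw2)
    (fun g => Subtype.ext (hwc g g.2))
    (fun a ha2 ha1 => Subtype.ext (hinv a a.2 (congrArg Subtype.val ha2)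
      (fun h => ha1 (Subtype.ext h))))
  have hxy : x * y ≠ y * x := fun h => hxy' (Subtype.ext h)
  have hx2 : x ^ 2 = w := congrArg Subtype.val hx2'
  have hy2 : y ^ 2 = w := congrArg Subtype.val hy2'
  have hr : y * x = x * y * w := congrArg Subtype.val hr'
  obtain ⟨f, hf, hfx, hfy⟩ := exists_q8_hom hxy (by rw [hx2]; exact hw1)
    (by rw [show (4 : ℕ) = 2 * 2 from rfl, pow_mul, hx2, hw2]) (by rw [hy2, hx2])
    (by
      have e : x⁻¹ = x * w⁻¹ := by rw [← hx2]; group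
      rw [e, ← mul_assoc, hr, mul_inv_cancel_right])
  have hfxm : x ∈ f.range := ⟨_, hfx⟩
  have hfym : y ∈ f.range := ⟨_, hfy⟩
  have hfH : f.range ≤ H := by
    rintro _ ⟨q, rfl⟩
    rcases q with i | i
    · have : (QuaternionGroup.a i : QuaternionGroup 2) = QuaternionGroup.a 1 ^ i.val := by
        rw [QuaternionGroup.a_one_pow, ZMod.natCast_zmod_val]
      rw [this, map_pow, hfx]
      exact pow_mem hxH _
    · have : (QuaternionGroup.xa i : QuaternionGroup 2) =
          QuaternionGroup.xa 0 * QuaternionGroup.a 1 ^ i.val := by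
        rw [QuaternionGroup.a_one_pow, ZMod.natCast_zmod_val, QuaternionGroup.xa_mul_a, zero_add]
      rw [this, map_mul, map_pow, hfx, hfy]
      exact mul_mem hyH (pow_mem hxH _)
  have hzr : z ∉ f.range := fun h => hzH (hfH h)
  have hcov := hB f.range hzr x hfxm y hfym hxy
  let g : Multiplicative (ZMod 2) →* G :=
    { toFun := fun e => z ^ (Multiplicative.toAdd e).val
      map_one' := by simp
      map_mul' := by
        intro e e'
        rw [toAdd_mul, ZMod.val_add, ← pow_add]
        exact (pow_eq_pow_mod _ hz2).symm }
  have hcomm : ∀ q e, Commute (f q) (g e) := by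
    intro q e
    have : Commute (f q) z := (hzc (f q)).symm
    exact this.pow_right _
  let F : QuaternionGroup 2 × Multiplicative (ZMod 2) →* G := f.noncommCoprod g hcomm
  have hg1 : g (Multiplicative.ofAdd 1) = z := pow_one z
  have hF : ∀ q e, F (q, e) = f q * g e := fun q e => rfl
  refine ⟨(MulEquiv.ofBijective F ⟨?_, ?_⟩).symm⟩
  · rw [injective_iff_map_eq_one]
    rintro ⟨q, e⟩ hqe
    rw [hF] at hqe
    have he : e = 1 ∨ e = Multiplicative.ofAdd 1 := by
      have key : ∀ e : Multiplicative (ZMod 2), e = 1 ∨ e = Multiplicative.ofAdd 1 := by decide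
      exact key e
    rcases he with rfl | rfl
    · rw [map_one, mul_one] at hqe
      have := (injective_iff_map_eq_one f).mp hf q hqe
      rw [this]; rfl
    · rw [hg1] at hqe
      exact absurd ⟨q⁻¹, by rw [map_inv]; exact inv_eq_of_mul_eq_one_right hqe⟩ hzr
  · intro k
    rcases hcov k with ⟨q, hq⟩ | ⟨q, hq⟩
    · exact ⟨(q, 1), by rw [hF, map_one, mul_one, hq]⟩
    · exact ⟨(q, Multiplicative.ofAdd 1), by rw [hF, hg1, hq, mul_assoc, hzz, mul_one]⟩
end

section
/- Let G be a finite nonabelian 2-group all of whose proper subgroups are abelian. Then G is minimally faithful of degree 3 if and only if every subgroup of G of index 2 is noncyclic and can be generated by two elements (i.e., every index-2 subgroup is abelian with exactly two invariant factors). -/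
theorem exists_GL_of_hom {G : Type*} [Group G] {n : Type*} [Fintype n] [DecidableEq n] {k : ℕ}
    (hk : Fintype.card n = k) (ρ : G →* Matrix n n ℂ) (hρ : Function.Injective ρ) :
    ∃ σ : G →* GL (Fin k) ℂ, Function.Injective σ := by
  let e : n ≃ Fin k := Fintype.equivFinOfCardEq hk
  let r : Matrix n n ℂ ≃ₐ[ℂ] Matrix (Fin k) (Fin k) ℂ := Matrix.reindexAlgEquiv ℂ ℂ e
  refine ⟨((r : Matrix n n ℂ →* Matrix (Fin k) (Fin k) ℂ).comp ρ).toHomUnits, ?_⟩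
  intro x y hxy
  apply hρ
  apply r.injective
  have := congrArg Units.val hxy
  simpa using this

theorem rdim_le_of_hom {G : Type*} [Group G] {n : Type*} [Fintype n] [DecidableEq n] {k : ℕ}
    (hk : Fintype.card n = k) (ρ : G →* Matrix n n ℂ) (hρ : Function.Injective ρ) :
    rdim G ≤ k :=
  Nat.sInf_le (exists_GL_of_hom hk ρ hρ)

theorem exists_hom_of_rdim_lt {G : Type*} [Group G] {k : ℕ}
    (hne : ∃ n, ∃ ρ : G →* GL (Fin n) ℂ, Function.Injective ρ) (h : rdim G < k) :
    ∃ n, n < k ∧ ∃ ρ : G →* GL (Fin n) ℂ, Function.Injective ρ :=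
  ⟨rdim G, h, Nat.sInf_mem (s := {n : ℕ | ∃ ρ : G →* GL (Fin n) ℂ, Function.Injective ρ}) hne⟩

theorem exists_two_chars {A : Type*} [CommGroup A] [Finite A] (a b : A)
    (h : Subgroup.closure {a, b} = ⊤) :
    ∃ χ₁ χ₂ : A →* ℂˣ, (∀ x, χ₁ x = 1 → χ₂ x = 1 → x = 1) ∧ (a = b → χ₁ = χ₂) := by
  obtain ⟨e⟩ := CommGroup.monoidHom_mulEquiv_of_hasEnoughRootsOfUnity A ℂ
  refine ⟨e.symm a, e.symm b, ?_, fun h => by rw [h]⟩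
  intro x h1 h2
  by_contra hx
  obtain ⟨φ, hφ⟩ := CommGroup.exists_apply_ne_one_of_hasEnoughRootsOfUnity A ℂ hx
  have hm : e φ ∈ Subgroup.closure {a, b} := by rw [h]; trivial
  obtain ⟨m, n, hmn⟩ := Subgroup.mem_closure_pair.1 hm
  apply hφ
  have : φ = (e.symm a) ^ m * (e.symm b) ^ n := by
    apply e.injective
    simp [← hmn]
  rw [this]
  simp [MonoidHom.mul_apply, h1, h2]

theorem two_gen_of_chars {A : Type*} [CommGroup A] [Finite A] (χ₁ χ₂ : A →* ℂˣ)
    (h : ∀ x, χ₁ x = 1 → χ₂ x = 1 → x = 1) : ∃ a b : A, Subgroup.closure {a, b} = ⊤ := by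
  have : Finite χ₁.range := Set.finite_range χ₁
  have hcr : IsCyclic χ₁.range :=
    isCyclic_of_injective_ringHom ((Units.coeHom ℂ).comp χ₁.range.subtype)
      (Units.val_injective.comp Subtype.val_injective)
  obtain ⟨⟨_, a, rfl⟩, ha⟩ := IsCyclic.exists_generator (α := χ₁.range)
  have hc : IsCyclic χ₁.ker := by
    apply isCyclic_of_injective_ringHom ((Units.coeHom ℂ).comp (χ₂.comp χ₁.ker.subtype))
    rw [injective_iff_map_eq_one]
    intro x hx
    have h2 : χ₂ (x : A) = 1 := by
      ext
      simpa using hx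
    ext
    exact h _ x.2 h2
  obtain ⟨b, hb⟩ := hc.exists_generator
  refine ⟨a, b, ?_⟩
  rw [eq_top_iff]
  intro x _
  rw [Subgroup.mem_closure_pair]
  obtain ⟨m, hm⟩ := Subgroup.mem_zpowers_iff.1 (ha ⟨χ₁ x, x, rfl⟩)
  have hm' : χ₁ a ^ m = χ₁ x := by simpa using congrArg Subtype.val hm
  have hk : a ^ (-m) * x ∈ χ₁.ker := by
    rw [MonoidHom.mem_ker, map_mul, map_zpow, zpow_neg, hm']; simp
  obtain ⟨n, hn⟩ := Subgroup.mem_zpowers_iff.1 (hb ⟨_, hk⟩)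
  have hn' : (b : A) ^ n = a ^ (-m) * x := by simpa using congrArg Subtype.val hn
  refine ⟨m, n, ?_⟩
  rw [hn']; simp

theorem diag_rdim {A : Type*} [CommGroup A] (χ₁ χ₂ : A →* ℂˣ)
    (h : ∀ x, χ₁ x = 1 → χ₂ x = 1 → x = 1) : rdim A ≤ 2 := by
  let f : A →* (Fin 2 → ℂ) :=
    MonoidHom.pi ![(Units.coeHom ℂ).comp χ₁, (Units.coeHom ℂ).comp χ₂]
  refine rdim_le_of_hom (n := Fin 2) (by simp)
    ((Matrix.diagonalRingHom (Fin 2) ℂ : (Fin 2 → ℂ) →* _).comp f) ?_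
  rw [injective_iff_map_eq_one]
  intro x hx
  have h0 := congrFun (congrFun hx 0) 0
  have h1 := congrFun (congrFun hx 1) 1
  simp [f] at h0 h1
  exact h x h0 h1

/-- the extension by zero of a character of a subgroup -/
noncomputable def extChar {G : Type*} [Group G] {H : Subgroup G} (χ : H →* ℂˣ) (g : G) : ℂ :=
  open Classical in if h : g ∈ H then (χ ⟨g, h⟩ : ℂ) else 0

theorem extChar_key {G : Type*} [Group G] {H : Subgroup G} (hH : H.index = 2) (χ : H →* ℂˣ)
    (t : G) (ht : t ∉ H) (x y : G) :
    extChar χ x * extChar χ y + extChar χ (x * t) * extChar χ (t⁻¹ * y) = extChar χ (x * y) := by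
  have e1 : ∀ u v, u ∈ H → extChar χ (u * v) = extChar χ u * extChar χ v := by
    intro u v hu
    by_cases hv : v ∈ H
    · simp only [extChar, hu, hv, H.mul_mem hu hv, dif_pos]
      rw [← Units.val_mul, ← map_mul]; rfl
    · have : u * v ∉ H := by rwa [H.mul_mem_cancel_left hu]
      simp [extChar, hv, this]
  have e0 : ∀ u, u ∉ H → extChar χ u = 0 := by
    intro u hu; simp [extChar, hu]
  by_cases hx : x ∈ H
  · have : x * t ∉ H := by rwa [H.mul_mem_cancel_left hx]
    rw [e0 _ this, e1 _ _ hx]; simp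
  · have : x * t ∈ H := by rw [Subgroup.mul_mem_iff_of_index_two hH]; tauto
    rw [e0 _ hx, ← e1 _ _ this]; simp [mul_assoc]

theorem exists_ind {G : Type*} [Group G] {H : Subgroup G} (hH : H.index = 2) (χ : H →* ℂˣ) :
    ∃ ρ : G →* Matrix (Fin 2) (Fin 2) ℂ, ∀ g, ρ g = 1 → ∃ h : g ∈ H, χ ⟨g, h⟩ = 1 := by
  obtain ⟨t, ht⟩ : ∃ t, t ∉ H := by
    by_contra! hc
    have : H = ⊤ := by ext; simp [hc]
    rw [this] at hH; simp at hH
  have e0 : ∀ u, u ∉ H → extChar χ u = 0 := by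
    intro u hu; simp [extChar, hu]
  have e1 : extChar χ 1 = 1 := by
    simp only [extChar, H.one_mem, dif_pos]
    exact congrArg Units.val (map_one χ)
  have ht' : t⁻¹ ∉ H := by simpa using ht
  refine ⟨{ toFun := fun g => !![extChar χ g, extChar χ (g * t);
              extChar χ (t⁻¹ * g), extChar χ (t⁻¹ * g * t)]
            map_one' := ?_
            map_mul' := ?_ }, ?_⟩
  · simp [e0 _ ht, e0 _ ht', e1, Matrix.one_fin_two]
  · intro x y
    rw [Matrix.mul_fin_two]
    have k := extChar_key hH χ t ht
    have k1 := k x y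
    have k2 := k x (y * t)
    have k3 := k (t⁻¹ * x) y
    have k4 := k (t⁻¹ * x) (y * t)
    simp only [mul_assoc] at k1 k2 k3 k4 ⊢
    rw [k1, k2, k3, k4]
  · intro g hg
    have := congrFun (congrFun hg 0) 0
    simp [extChar] at this
    by_cases h : g ∈ H
    · refine ⟨h, ?_⟩
      rw [dif_pos h] at this
      ext; simpa using this
    · simp [h] at this

theorem exists_GL3 {G : Type*} [Group G] (ρ : G →* Matrix (Fin 2) (Fin 2) ℂ) (l : G →* ℂˣ)
    (h : ∀ g, ρ g = 1 → l g = 1 → g = 1) :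
    ∃ σ : G →* GL (Fin 3) ℂ, Function.Injective σ := by
  refine exists_GL_of_hom (n := Fin 2 ⊕ Fin 1) (by simp)
    { toFun := fun g => Matrix.fromBlocks (ρ g) 0 0 (Matrix.diagonal fun _ => (l g : ℂ))
      map_one' := by simp
      map_mul' := by intro x y; simp [Matrix.fromBlocks_multiply] } ?_
  rw [injective_iff_map_eq_one]
  intro g hg
  rw [MonoidHom.coe_mk, OneHom.coe_mk, ← Matrix.fromBlocks_one, Matrix.fromBlocks_inj] at hg
  refine h g hg.1 ?_
  have := congrFun (congrFun hg.2.2.2 0) 0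
  ext; simpa using this

theorem chars_of_GL {A : Type*} [CommGroup A] [Finite A] {m : ℕ} (hm : m < 3)
    (ρ : A →* GL (Fin m) ℂ) (hρ : Function.Injective ρ) :
    ∃ χ₁ χ₂ : A →* ℂˣ, ∀ x, χ₁ x = 1 → χ₂ x = 1 → x = 1 := by
  classical
  let f : A →* Module.End ℂ (Fin m → ℂ) :=
    ((Matrix.toLinAlgEquiv' : Matrix (Fin m) (Fin m) ℂ ≃ₐ[ℂ] _) :
      Matrix (Fin m) (Fin m) ℂ →* Module.End ℂ (Fin m → ℂ)).comp
      ((Units.coeHom _).comp ρ)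
  have hf : ∀ x, f x = 1 → x = 1 := by
    intro x hx
    apply hρ
    rw [map_one]
    ext1
    apply (Matrix.toLinAlgEquiv' : Matrix (Fin m) (Fin m) ℂ ≃ₐ[ℂ] _).injective
    rw [Units.val_one, map_one]
    exact hx
  have hcomm : ∀ x y, Commute (f x) (f y) := fun x y => (Commute.all x y).map f
  have hss : ∀ x, (f x).IsSemisimple := by
    intro x
    obtain ⟨n, hn, hx⟩ := isOfFinOrder_iff_pow_eq_one.1 (isOfFinOrder_of_finite x)
    refine Module.End.isSemisimple_of_squarefree_aeval_eq_zero (p := Polynomial.X ^ n - 1) ?_ ?_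
    · apply Polynomial.Separable.squarefree
      apply Polynomial.separable_X_pow_sub_C (1 : ℂ) _ one_ne_zero
      exact_mod_cast hn.ne'
    · rw [map_sub, map_pow, Polynomial.aeval_X, map_one, ← map_pow, hx, map_one, sub_self]
  have heq : ∀ x μ, (f x).maxGenEigenspace μ = (f x).eigenspace μ := fun x μ =>
    (hss x).isFinitelySemisimple.maxGenEigenspace_eq_eigenspace μ
  have hind := Module.End.independent_iInf_maxGenEigenspace_of_forall_mapsTo (fun x => f x)
    (fun i j φ => Module.End.mapsTo_maxGenEigenspace_of_comm (hcomm j i) φ)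
  have htop := Module.End.iSup_iInf_maxGenEigenspace_eq_top_of_iSup_maxGenEigenspace_eq_top_of_commute
    (fun x => f x) (fun i j _ => hcomm i j) (fun x => Module.End.iSup_maxGenEigenspace_eq_top _)
  simp only [heq] at hind htop
  let W : (A → ℂ) → Submodule ℂ (Fin m → ℂ) := fun χ => ⨅ x, (f x).eigenspace (χ x)
  have hW : ∀ χ v, v ∈ W χ ↔ ∀ x, f x v = χ x • v := by
    intro χ v; simp [W]
  have : Fintype {χ // W χ ≠ ⊥} := hind.fintypeNeBotOfFiniteDimensional
  have hcard : Fintype.card {χ // W χ ≠ ⊥} ≤ 2 := by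
    have := hind.subtype_ne_bot_le_finrank
    simp at this
    exact this.trans (by omega)
  have hmul : ∀ c : {χ // W χ ≠ ⊥}, ∃ ψ : A →* ℂˣ, ∀ x, (ψ x : ℂ) = c.1 x := by
    rintro ⟨χ, hχ⟩
    obtain ⟨v, hv, hv0⟩ := Submodule.exists_mem_ne_zero_of_ne_bot hχ
    rw [hW] at hv
    refine ⟨MonoidHom.toHomUnits
      { toFun := χ
        map_one' := ?_
        map_mul' := ?_ }, fun x => rfl⟩
    · have := hv 1
      rw [map_one] at this
      apply smul_left_injective ℂ hv0
      simpa using this.symm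
    · intro x y
      apply smul_left_injective ℂ hv0
      have := hv (x * y)
      rw [map_mul, Module.End.mul_apply, hv y, map_smul, hv x] at this
      simp only
      rw [← this, smul_smul, mul_comm]
  choose ψ hψ using hmul
  have key : ∀ x, (∀ c, ψ c x = 1) → x = 1 := by
    intro x hx
    apply hf
    have : (⊤ : Submodule ℂ (Fin m → ℂ)) ≤ (f x).eigenspace 1 := by
      rw [← htop]
      apply iSup_le
      intro χ
      by_cases hχ : W χ = ⊥
      · change W χ ≤ _
        rw [hχ]; exact bot_le
      · have h1 : χ x = 1 := by
          have := hψ ⟨χ, hχ⟩ x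
          rw [hx] at this
          simpa using this.symm
        rw [← h1]
        exact iInf_le _ x
    refine LinearMap.ext fun v => ?_
    have hv := this (x := v) trivial
    rw [Module.End.mem_eigenspace_iff] at hv
    simpa using hv
  obtain ⟨g⟩ : Nonempty ({χ // W χ ≠ ⊥} ↪ Fin 2) :=
    Function.Embedding.nonempty_of_card_le (by simpa using hcard)
  let Φ : Fin 2 → (A →* ℂˣ) := fun i => if h : ∃ c, g c = i then ψ h.choose else 1
  have hΦ : ∀ c, Φ (g c) = ψ c := by
    intro c
    have h : ∃ c', g c' = g c := ⟨c, rfl⟩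
    simp only [Φ, dif_pos h]
    rw [g.injective h.choose_spec]
  refine ⟨Φ 0, Φ 1, fun x h0 h1 => key x fun c => ?_⟩
  rw [← hΦ]
  have : ∀ i, Φ i x = 1 := by
    intro i; fin_cases i <;> assumption
  exact this _

section MinNonab

set_option linter.unusedSectionVars false

variable {G : Type*} [Group G] [Finite G]

theorem exists_index_two_ge (hp : IsPGroup 2 G) (H : Subgroup G) (hH : H ≠ ⊤) :
    ∃ K : Subgroup G, K.index = 2 ∧ H ≤ K := by
  have : Fact (Nat.Prime 2) := ⟨Nat.prime_two⟩
  obtain ⟨n, hn⟩ := IsPGroup.iff_card.1 hp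
  obtain ⟨m, hm⟩ := IsPGroup.iff_card.1 (hp.to_subgroup H)
  have hlt : m < n := by
    have h1 : Nat.card H ≠ Nat.card G := fun h => hH (Subgroup.eq_top_of_card_eq _ h)
    have h2 : Nat.card H ≤ Nat.card G := Subgroup.card_le_card_group H
    have h3 : 2 ^ m < 2 ^ n := by rw [← hm, ← hn]; omega
    exact (Nat.pow_lt_pow_iff_right (by norm_num)).1 h3
  obtain ⟨k, rfl⟩ : ∃ k, n = k + 1 := ⟨n - 1, by omega⟩
  obtain ⟨K, hK, hle⟩ := Sylow.exists_subgroup_card_pow_prime_le (G := G) 2 (n := m) (m := k)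
    (by rw [hn]; exact pow_dvd_pow _ (by omega)) H hm (by omega)
  refine ⟨K, ?_, hle⟩
  have := K.card_mul_index
  rw [hK, hn, pow_succ] at this
  exact Nat.eq_of_mul_eq_mul_left (by positivity) this

theorem ne_top_of_index_two {K : Subgroup G} (hK : K.index = 2) : K ≠ ⊤ := by
  rintro rfl
  simp at hK

theorem closure_pair_top (hab : ∀ H : Subgroup G, H ≠ ⊤ → ∀ a b : H, a * b = b * a)
    {a b : G} (h : a * b ≠ b * a) : Subgroup.closure {a, b} = ⊤ := by
  by_contra hc
  apply h
  have := hab _ hc ⟨a, Subgroup.subset_closure (by simp)⟩ ⟨b, Subgroup.subset_closure (by simp)⟩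
  exact congrArg Subtype.val this

theorem mem_center_of_pair (hab : ∀ H : Subgroup G, H ≠ ⊤ → ∀ a b : H, a * b = b * a)
    {a b : G} (h : a * b ≠ b * a) {x : G} (ha : a * x = x * a) (hb : b * x = x * b) :
    x ∈ Subgroup.center G := by
  have : (⊤ : Subgroup G) ≤ Subgroup.centralizer {x} := by
    rw [← closure_pair_top hab h, Subgroup.closure_le]
    rintro y (rfl | rfl)
    · simpa [Subgroup.mem_centralizer_singleton_iff] using ha
    · simpa [Subgroup.mem_centralizer_singleton_iff] using hb
  rw [Subgroup.mem_center_iff]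
  intro g
  have := this (x := g) trivial
  simpa [Subgroup.mem_centralizer_singleton_iff] using this

theorem comm_of_mem (hab : ∀ H : Subgroup G, H ≠ ⊤ → ∀ a b : H, a * b = b * a)
    {K : Subgroup G} (hK : K.index = 2) {x y : G} (hx : x ∈ K) (hy : y ∈ K) :
    x * y = y * x :=
  congrArg Subtype.val (hab K (ne_top_of_index_two hK) ⟨x, hx⟩ ⟨y, hy⟩)

theorem exists_index_two_mem (hp : IsPGroup 2 G) (hna : ¬ ∀ a b : G, a * b = b * a) (a : G) :
    ∃ K : Subgroup G, K.index = 2 ∧ a ∈ K := by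
  obtain ⟨K, hK, hle⟩ := exists_index_two_ge hp (Subgroup.zpowers a) (by
    intro h
    apply hna
    intro x y
    have hx : x ∈ Subgroup.zpowers a := by rw [h]; trivial
    have hy : y ∈ Subgroup.zpowers a := by rw [h]; trivial
    obtain ⟨m, rfl⟩ := hx
    obtain ⟨n, rfl⟩ := hy
    exact (Commute.refl a).zpow_zpow m n)
  exact ⟨K, hK, hle (Subgroup.mem_zpowers a)⟩

theorem mem_center_of_forall (hp : IsPGroup 2 G)
    (hna : ¬ ∀ a b : G, a * b = b * a)
    (hab : ∀ H : Subgroup G, H ≠ ⊤ → ∀ a b : H, a * b = b * a) {x : G}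
    (h : ∀ K : Subgroup G, K.index = 2 → x ∈ K) : x ∈ Subgroup.center G := by
  rw [Subgroup.mem_center_iff]
  intro g
  obtain ⟨K, hK, hg⟩ := exists_index_two_mem hp hna g
  exact comm_of_mem hab hK hg (h K hK)

theorem center_mem (hna : ¬ ∀ a b : G, a * b = b * a)
    (hab : ∀ H : Subgroup G, H ≠ ⊤ → ∀ a b : H, a * b = b * a) {x : G}
    (hx : x ∈ Subgroup.center G) {K : Subgroup G} (hK : K.index = 2) : x ∈ K := by
  by_contra hxK
  rw [Subgroup.mem_center_iff] at hx
  apply hna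
  have aux : ∀ g, ∃ k ∈ K, ∃ y, (∀ g, g * y = y * g) ∧ g = k * y := by
    intro g
    by_cases hg : g ∈ K
    · exact ⟨g, hg, 1, by simp, by simp⟩
    · refine ⟨g * x, ?_, x⁻¹, fun g => ?_, by simp⟩
      · rw [Subgroup.mul_mem_iff_of_index_two hK]; tauto
      · exact (show Commute g x from hx g).inv_right
  intro g h
  obtain ⟨k, hk, y, hy, rfl⟩ := aux g
  obtain ⟨l, hl, w, hw, rfl⟩ := aux h
  calc k * y * (l * w) = (k * l) * y * w := by rw [mul_assoc k y, ← mul_assoc y, ← hy l]; group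
    _ = (l * k) * (y * w) := by rw [comm_of_mem hab hK hk hl]; group
    _ = (l * k) * (w * y) := by rw [hw y]
    _ = l * w * (k * y) := by rw [mul_assoc l w, ← mul_assoc w, ← hw k]; group

theorem sq_mem_center (hp : IsPGroup 2 G) (hna : ¬ ∀ a b : G, a * b = b * a)
    (hab : ∀ H : Subgroup G, H ≠ ⊤ → ∀ a b : H, a * b = b * a) (x : G) :
    x ^ 2 ∈ Subgroup.center G :=
  mem_center_of_forall hp hna hab fun _ hK => Subgroup.sq_mem_of_index_two hK x

theorem comm_mem_center (hp : IsPGroup 2 G) (hna : ¬ ∀ a b : G, a * b = b * a)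
    (hab : ∀ H : Subgroup G, H ≠ ⊤ → ∀ a b : H, a * b = b * a) (a b : G) :
    a * b * a⁻¹ * b⁻¹ ∈ Subgroup.center G :=
  mem_center_of_forall hp hna hab fun K hK => by
    simp only [Subgroup.mul_mem_iff_of_index_two hK, inv_mem_iff]; tauto

theorem comm_sq (hp : IsPGroup 2 G) (hna : ¬ ∀ a b : G, a * b = b * a)
    (hab : ∀ H : Subgroup G, H ≠ ⊤ → ∀ a b : H, a * b = b * a) (a b : G) :
    (a * b * a⁻¹ * b⁻¹) ^ 2 = 1 := by
  have hz := Subgroup.mem_center_iff.1 (comm_mem_center hp hna hab a b)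
  have ha := Subgroup.mem_center_iff.1 (sq_mem_center hp hna hab a) b
  set z := a * b * a⁻¹ * b⁻¹ with hzdef
  have h1 : a * b = z * b * a := by rw [hzdef]; group
  have h2 : a ^ 2 * b = z ^ 2 * (b * a ^ 2) := by
    calc a ^ 2 * b = a * (a * b) := by rw [pow_two, mul_assoc]
      _ = (a * z) * b * a := by rw [h1]; group
      _ = z * (a * b) * a := by rw [hz a]; group
      _ = z ^ 2 * (b * a ^ 2) := by rw [h1]; simp only [pow_two, mul_assoc]
  rw [ha] at h2
  exact right_eq_mul.1 h2

theorem commutator_le_zpowers (hp : IsPGroup 2 G) (hna : ¬ ∀ a b : G, a * b = b * a)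
    (hab : ∀ H : Subgroup G, H ≠ ⊤ → ∀ a b : H, a * b = b * a) {a b : G}
    (h : a * b ≠ b * a) :
    commutator G ≤ Subgroup.zpowers (a * b * a⁻¹ * b⁻¹) := by
  have hz := Subgroup.mem_center_iff.1 (comm_mem_center hp hna hab a b)
  set z := a * b * a⁻¹ * b⁻¹ with hzdef
  have hN : (Subgroup.zpowers z).Normal := by
    constructor
    rintro n ⟨k, rfl⟩ g
    have : g * z ^ k = z ^ k * g := (show Commute g z from hz g).zpow_right k
    simp only [this]
    simp
  rw [← Subgroup.Normal.quotient_commutative_iff_commutator_le]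
  let q := QuotientGroup.mk' (Subgroup.zpowers z)
  have hq : q a * q b = q b * q a := by
    have h1 : q (a * b * a⁻¹ * b⁻¹) = 1 := by
      rw [← hzdef]
      exact (QuotientGroup.eq_one_iff _).2 (Subgroup.mem_zpowers z)
    rw [map_mul, map_mul, map_mul, map_inv, map_inv] at h1
    rw [mul_inv_eq_one, mul_inv_eq_iff_eq_mul] at h1
    exact h1
  have step : ∀ x : G, q a * q x = q x * q a → q b * q x = q x * q b → ∀ g, q g * q x = q x * q g := by
    intro x h1 h2 g
    have hle : (⊤ : Subgroup G) ≤ (Subgroup.centralizer {q x}).comap q := by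
      rw [← closure_pair_top hab h, Subgroup.closure_le]
      rintro y (rfl | rfl)
      · simpa [Subgroup.mem_centralizer_singleton_iff] using h1
      · simpa [Subgroup.mem_centralizer_singleton_iff] using h2
    have := hle (x := g) trivial
    simpa [Subgroup.mem_centralizer_singleton_iff] using this
  have hA := step a rfl hq.symm
  have hB := step b hq rfl
  have hall : ∀ x g, q g * q x = q x * q g := fun x => step x (hA x).symm (hB x).symm
  refine ⟨⟨fun x y => ?_⟩⟩
  obtain ⟨x, rfl⟩ := QuotientGroup.mk'_surjective _ x
  obtain ⟨y, rfl⟩ := QuotientGroup.mk'_surjective _ y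
  exact hall y x

theorem mem_zpowers_of_sq {z x : G} (hz : z ^ 2 = 1) (hx : x ∈ Subgroup.zpowers z) :
    x = 1 ∨ x = z := by
  obtain ⟨k, rfl⟩ := hx
  rcases Int.even_or_odd' k with ⟨m, rfl | rfl⟩
  · left; simp [zpow_mul, hz]
  · right; simp [zpow_mul, zpow_add, hz]

theorem exists_linear_char {w : G} (hw : w ∉ commutator G) : ∃ l : G →* ℂˣ, l w ≠ 1 := by
  have : Abelianization.of w ≠ 1 := by
    intro h
    exact hw ((QuotientGroup.eq_one_iff _).1 h)
  obtain ⟨φ, hφ⟩ := CommGroup.exists_apply_ne_one_of_hasEnoughRootsOfUnity _ ℂ this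
  exact ⟨φ.comp Abelianization.of, hφ⟩

theorem exists_GL3_of (hp : IsPGroup 2 G) (hna : ¬ ∀ a b : G, a * b = b * a)
    (hab : ∀ H : Subgroup G, H ≠ ⊤ → ∀ a b : H, a * b = b * a)
    {H : Subgroup G} (hH : H.index = 2) (χ₁ χ₂ : H →* ℂˣ)
    (hχ : ∀ x, χ₁ x = 1 → χ₂ x = 1 → x = 1) :
      ∃ σ : G →* GL (Fin 3) ℂ, Function.Injective σ := by
  obtain ⟨a, b, h⟩ : ∃ a b : G, a * b ≠ b * a := by
    by_contra! hc; exact hna hc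
  have hzc := comm_mem_center hp hna hab a b
  have hz2 := comm_sq hp hna hab a b
  have hcz := commutator_le_zpowers hp hna hab h
  have hz1 : a * b * a⁻¹ * b⁻¹ ≠ 1 := by
    intro h1
    rw [mul_inv_eq_one, mul_inv_eq_iff_eq_mul] at h1
    exact h h1
  set z := a * b * a⁻¹ * b⁻¹ with hzdef
  have hzH : z ∈ H := center_mem hna hab hzc hH
  have main : ∀ χ₁ χ₂ : H →* ℂˣ, (∀ x, χ₁ x = 1 → χ₂ x = 1 → x = 1) → χ₁ ⟨z, hzH⟩ ≠ 1 →
      ∃ σ : G →* GL (Fin 3) ℂ, Function.Injective σ := by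
    intro χ₁ χ₂ hχ hz
    obtain ⟨ρ, hρ⟩ := exists_ind hH χ₁
    have huniq : ∀ x y : G, ρ x = 1 → ρ y = 1 → x ^ 2 = 1 → y ^ 2 = 1 → x ≠ 1 → y ≠ 1 → x = y := by
      have aux : ∀ x : G, ∀ hx : ρ x = 1, x ^ 2 = 1 → x ≠ 1 → χ₂ ⟨x, (hρ x hx).1⟩ = -1 := by
        intro x hx hx2 hx1
        obtain ⟨hxH, hx3⟩ := hρ x hx
        have h4 : χ₂ ⟨x, hxH⟩ ≠ 1 := fun h5 => hx1 (congrArg Subtype.val (hχ _ hx3 h5))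
        have h5 : (χ₂ ⟨x, hxH⟩) ^ 2 = 1 := by
          rw [← map_pow]
          have : (⟨x, hxH⟩ : H) ^ 2 = 1 := Subtype.ext hx2
          rw [this, map_one]
        have h6 : ((χ₂ ⟨x, hxH⟩ : ℂˣ) : ℂ) ^ 2 = 1 := by
          rw [← Units.val_pow_eq_pow_val, h5, Units.val_one]
        rcases sq_eq_one_iff.1 h6 with h7 | h7
        · exact absurd (Units.ext h7) h4
        · exact Units.ext (by simpa using h7)
      intro x y hx hy hx2 hy2 hx1 hy1
      have ex := aux x hx hx2 hx1
      have ey := aux y hy hy2 hy1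
      obtain ⟨hxH, hx3⟩ := hρ x hx
      obtain ⟨hyH, hy3⟩ := hρ y hy
      have := hχ (⟨x, hxH⟩ * ⟨y, hyH⟩⁻¹) (by rw [map_mul, map_inv, hx3, hy3]; simp)
        (by rw [map_mul, map_inv, ex, ey]; simp)
      rw [mul_inv_eq_one] at this
      exact congrArg Subtype.val this
    have hinv : ∀ x : G, x ≠ 1 → ∃ n : ℕ, (x ^ n) ^ 2 = 1 ∧ x ^ n ≠ 1 := by
      intro x hx
      obtain ⟨k, hk⟩ := (IsPGroup.iff_orderOf.1 hp) x
      rcases k with _ | k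
      · rw [pow_zero, orderOf_eq_one_iff] at hk; exact absurd hk hx
      · refine ⟨2 ^ k, ?_, ?_⟩
        · rw [← pow_mul, ← pow_succ, ← hk, pow_orderOf_eq_one]
        · intro h
          have := orderOf_dvd_of_pow_eq_one h
          rw [hk] at this
          have := Nat.le_of_dvd (by positivity) this
          rw [pow_succ] at this
          have : 0 < 2 ^ k := by positivity
          omega
    by_cases hex : ∃ w : G, ρ w = 1 ∧ w ^ 2 = 1 ∧ w ≠ 1
    · obtain ⟨w, hw, hw2, hw1⟩ := hex
      obtain ⟨l, hl⟩ := exists_linear_char (w := w) (by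
        intro hc
        rcases mem_zpowers_of_sq hz2 (hcz hc) with h1 | rfl
        · exact hw1 h1
        · exact hz (hρ _ hw).2)
      refine exists_GL3 ρ l fun g hg1 hg2 => ?_
      by_contra hg
      obtain ⟨n, hn1, hn2⟩ := hinv g hg
      have := huniq (g ^ n) w (by rw [map_pow, hg1, one_pow]) hw hn1 hw2 hn2 hw1
      apply hl
      rw [← this, map_pow, hg2, one_pow]
    · refine exists_GL3 ρ 1 fun g hg1 _ => ?_
      by_contra hg
      obtain ⟨n, hn1, hn2⟩ := hinv g hg
      exact hex ⟨g ^ n, by rw [map_pow, hg1, one_pow], hn1, hn2⟩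
  by_cases h1 : χ₁ ⟨z, hzH⟩ = 1
  · refine main χ₂ χ₁ (fun x hx hy => hχ x hy hx) fun h2 => hz1 ?_
    exact congrArg Subtype.val (hχ _ h1 h2)
  · exact main χ₁ χ₂ hχ h1

end MinNonab

theorem mat_comm_of_nonscalar (A B C : Matrix (Fin 2) (Fin 2) ℂ) (hAB : A * B = B * A)
    (hAC : A * C = C * A) (hA : ¬ (A 0 1 = 0 ∧ A 1 0 = 0 ∧ A 0 0 = A 1 1)) : B * C = C * B := by
  have b0 := congrFun (congrFun hAB 0) 0
  have b1 := congrFun (congrFun hAB 0) 1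
  have b2 := congrFun (congrFun hAB 1) 0
  have c0 := congrFun (congrFun hAC 0) 0
  have c1 := congrFun (congrFun hAC 0) 1
  have c2 := congrFun (congrFun hAC 1) 0
  simp only [Matrix.mul_apply, Fin.sum_univ_two] at b0 b1 b2 c0 c1 c2
  have hA' : A 0 1 ≠ 0 ∨ A 1 0 ≠ 0 ∨ A 0 0 - A 1 1 ≠ 0 := by
    by_contra! hc
    exact hA ⟨hc.1, hc.2.1, sub_eq_zero.1 hc.2.2⟩
  ext i j
  fin_cases i <;> fin_cases j <;> simp only [Matrix.mul_apply, Fin.sum_univ_two, Fin.zero_eta,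
    Fin.mk_one] <;> rcases hA' with h | h | h <;> grind

section Lower

set_option linter.unusedSectionVars false

variable {G : Type*} [Group G] [Finite G]

theorem center_cyclic_of_GL2 (hna : ¬ ∀ a b : G, a * b = b * a)
    (ρ : G →* GL (Fin 2) ℂ) (hρ : Function.Injective ρ) : IsCyclic (Subgroup.center G) := by
  have hs : ∀ x ∈ Subgroup.center G, ((ρ x).val 0 1 = 0 ∧ (ρ x).val 1 0 = 0 ∧
      (ρ x).val 0 0 = (ρ x).val 1 1) := by
    intro x hx
    by_contra hc
    apply hna
    intro a b
    rw [Subgroup.mem_center_iff] at hx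
    apply hρ
    rw [map_mul, map_mul]
    ext1
    rw [Units.val_mul, Units.val_mul]
    apply mat_comm_of_nonscalar _ _ _ _ _ hc
    · rw [← Units.val_mul, ← Units.val_mul, ← map_mul, ← map_mul, hx]
    · rw [← Units.val_mul, ← Units.val_mul, ← map_mul, ← map_mul, hx]
  refine isCyclic_of_injective_ringHom (R := ℂ)
    { toFun := fun x : Subgroup.center G => (ρ x).val 0 0
      map_one' := by simp
      map_mul' := ?_ } ?_
  · intro x y
    have := hs x x.2
    simp [Matrix.mul_apply, Fin.sum_univ_two, this.1]
  · intro x y hxy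
    have hx := hs x x.2
    have hy := hs y y.2
    have hxy' : (ρ x).val 0 0 = (ρ y).val 0 0 := hxy
    apply Subtype.ext
    apply hρ
    ext i j
    fin_cases i <;> fin_cases j
    · exact hxy'
    · exact hx.1.trans hy.1.symm
    · exact hx.2.1.trans hy.2.1.symm
    · exact (hx.2.2.symm.trans hxy').trans hy.2.2

theorem sq_eq_center_sq (hp : IsPGroup 2 G) (hna : ¬ ∀ a b : G, a * b = b * a)
    (hab : ∀ H : Subgroup G, H ≠ ⊤ → ∀ a b : H, a * b = b * a)
    (hnc : ∀ H : Subgroup G, H.index = 2 → ¬ IsCyclic H)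
    (hZ : IsCyclic (Subgroup.center G)) {a b : G} (h : a * b ≠ b * a) :
    ∃ x ∈ Subgroup.center G, a ^ 2 = x ^ 2 := by
  obtain ⟨⟨c, hc⟩, hgen⟩ := hZ.exists_generator
  have hgen' : ∀ x ∈ Subgroup.center G, ∃ k : ℤ, c ^ k = x := by
    intro x hx
    obtain ⟨k, hk⟩ := Subgroup.mem_zpowers_iff.1 (hgen ⟨x, hx⟩)
    exact ⟨k, by simpa using congrArg Subtype.val hk⟩
  obtain ⟨k, hk⟩ := hgen' _ (sq_mem_center hp hna hab a)
  rcases Int.even_or_odd' k with ⟨m, rfl | rfl⟩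
  · refine ⟨c ^ m, Subgroup.zpow_mem _ hc m, ?_⟩
    rw [← hk, mul_comm, zpow_mul]; norm_cast
  exfalso
  -- `c` is a power of `a`
  have hca : c ∈ Subgroup.zpowers a := by
    obtain ⟨n, hn⟩ := (IsPGroup.iff_orderOf.1 hp) c
    have hcop : IsCoprime (2 * m + 1) ((2 : ℤ) ^ n) := by
      apply IsCoprime.pow_right
      exact ⟨1, -m, by ring⟩
    obtain ⟨u, v, huv⟩ := hcop
    have h1 : c ^ ((2 : ℤ) ^ n) = 1 := by
      have := pow_orderOf_eq_one c
      rw [hn] at this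
      exact_mod_cast this
    refine ⟨2 * u, ?_⟩
    calc a ^ (2 * u) = (a ^ 2) ^ u := by rw [zpow_mul]; norm_cast
      _ = c ^ (u * (2 * m + 1)) := by rw [← hk, ← zpow_mul, mul_comm]
      _ = c ^ (u * (2 * m + 1) + v * 2 ^ n) := by
          rw [zpow_add, mul_comm v, zpow_mul c (2 ^ n), h1]; simp
      _ = c := by rw [huv]; simp
  obtain ⟨Ma, hMa, haM⟩ := exists_index_two_mem hp hna a
  obtain ⟨Mb, hMb, hbM⟩ := exists_index_two_mem hp hna b
  have haMb : a ∉ Mb := fun hc => h (comm_of_mem hab hMb hc hbM)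
  have hcen : ∀ x ∈ Ma, x ∈ Mb → x ∈ Subgroup.zpowers a := by
    intro x hx1 hx2
    obtain ⟨j, rfl⟩ := hgen' x (mem_center_of_pair hab h (comm_of_mem hab hMa haM hx1)
      (comm_of_mem hab hMb hbM hx2))
    exact Subgroup.zpow_mem _ hca j
  have hall : ∀ x ∈ Ma, x ∈ Subgroup.zpowers a := by
    intro x hx
    by_cases hxb : x ∈ Mb
    · exact hcen x hx hxb
    · have := hcen (a⁻¹ * x) (Ma.mul_mem (Ma.inv_mem haM) hx) (by
        rw [Subgroup.mul_mem_iff_of_index_two hMb, inv_mem_iff]; tauto)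
      simpa using (Subgroup.zpowers a).mul_mem (Subgroup.mem_zpowers a) this
  apply hnc Ma hMa
  refine ⟨⟨a, haM⟩, fun x => ?_⟩
  obtain ⟨j, hj⟩ := hall x x.2
  exact ⟨j, Subtype.ext (by simpa using hj)⟩

theorem no_GL2 (hp : IsPGroup 2 G) (hna : ¬ ∀ a b : G, a * b = b * a)
    (hab : ∀ H : Subgroup G, H ≠ ⊤ → ∀ a b : H, a * b = b * a)
    (hnc : ∀ H : Subgroup G, H.index = 2 → ¬ IsCyclic H)
    (hZ : IsCyclic (Subgroup.center G)) : False := by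
  obtain ⟨a₀, b₀, h₀⟩ : ∃ a b : G, a * b ≠ b * a := by
    by_contra! hc; exact hna hc
  obtain ⟨x, hx, hax⟩ := sq_eq_center_sq hp hna hab hnc hZ h₀
  obtain ⟨y, hy, hby⟩ := sq_eq_center_sq hp hna hab hnc hZ h₀.symm
  -- replace by involutions
  obtain ⟨a, b, ha, hb, h⟩ : ∃ a b : G, a ^ 2 = 1 ∧ b ^ 2 = 1 ∧ a * b ≠ b * a := by
    have hx' : ∀ g, Commute g x⁻¹ := fun g =>
      (show Commute g x from Subgroup.mem_center_iff.1 hx g).inv_right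
    have hy' : ∀ g, Commute g y⁻¹ := fun g =>
      (show Commute g y from Subgroup.mem_center_iff.1 hy g).inv_right
    refine ⟨a₀ * x⁻¹, b₀ * y⁻¹, ?_, ?_, ?_⟩
    · rw [(hx' a₀).mul_pow, hax, inv_pow, mul_inv_cancel]
    · rw [(hy' b₀).mul_pow, hby, inv_pow, mul_inv_cancel]
    · intro hc
      apply h₀
      have e1 : a₀ * x⁻¹ * (b₀ * y⁻¹) = a₀ * b₀ * (x⁻¹ * y⁻¹) := by
        rw [mul_assoc a₀, ← mul_assoc x⁻¹, ← (hx' b₀).eq]; simp only [mul_assoc]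
      have e2 : b₀ * y⁻¹ * (a₀ * x⁻¹) = b₀ * a₀ * (x⁻¹ * y⁻¹) := by
        rw [mul_assoc b₀, ← mul_assoc y⁻¹, ← (hy' a₀).eq, (hy' x⁻¹).eq]; simp only [mul_assoc]
      rw [e1, e2] at hc
      exact mul_right_cancel hc
  have hab' : (a * b) * b ≠ b * (a * b) := by
    intro hc
    rw [← mul_assoc] at hc
    exact h (mul_right_cancel hc)
  obtain ⟨u, hu, hu2⟩ := sq_eq_center_sq hp hna hab hnc hZ hab'
  have hz := Subgroup.mem_center_iff.1 (comm_mem_center hp hna hab a b)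
  have hz2 := comm_sq hp hna hab a b
  have hai : a⁻¹ = a := inv_eq_of_mul_eq_one_left (by rw [← pow_two, ha])
  have hbi : b⁻¹ = b := inv_eq_of_mul_eq_one_left (by rw [← pow_two, hb])
  have hz1 : a * b * a⁻¹ * b⁻¹ ≠ 1 := by
    intro h1
    rw [mul_inv_eq_one, mul_inv_eq_iff_eq_mul] at h1
    exact h h1
  have hzu : a * b * a⁻¹ * b⁻¹ = u ^ 2 := by
    rw [← hu2, hai, hbi, pow_two]; simp only [mul_assoc]
  set z := a * b * a⁻¹ * b⁻¹ with hzdef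
  have hba : b * a = a * b * z := by
    have h1 : a * b = z * (b * a) := by rw [hzdef]; group
    rw [hz, h1, ← mul_assoc, ← pow_two, hz2, one_mul]
  -- normal form
  have hform : ∀ g ∈ Subgroup.closure ({a, b} : Set G), ∃ i j k : ℕ, g = a ^ i * b ^ j * z ^ k := by
    have hzk : ∀ (g : G) (k : ℕ), g * z ^ k = z ^ k * g := fun g k =>
      (show Commute g z from hz g).pow_right k
    have hbj : ∀ j : ℕ, b ^ j * a = a * b ^ j * z ^ j := by
      intro j
      induction j with
      | zero => simp
      | succ j ih =>
        calc b ^ (j + 1) * a = b * (b ^ j * a) := by rw [pow_succ']; simp only [mul_assoc]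
          _ = (b * a) * b ^ j * z ^ j := by rw [ih]; simp only [mul_assoc]
          _ = a * b * (z * b ^ j) * z ^ j := by rw [hba]; simp only [mul_assoc]
          _ = a * (b * b ^ j) * (z * z ^ j) := by rw [← hz]; simp only [mul_assoc]
          _ = a * b ^ (j + 1) * z ^ (j + 1) := by rw [pow_succ' b, pow_succ' z]
    have stepa : ∀ g : G, (∃ i j k : ℕ, g = a ^ i * b ^ j * z ^ k) →
        ∃ i j k : ℕ, g * a = a ^ i * b ^ j * z ^ k := by
      rintro _ ⟨i, j, k, rfl⟩
      refine ⟨i + 1, j, j + k, ?_⟩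
      calc a ^ i * b ^ j * z ^ k * a = a ^ i * (b ^ j * a) * z ^ k := by
            rw [mul_assoc _ (z ^ k), ← hzk a]; simp only [mul_assoc]
        _ = a ^ (i + 1) * b ^ j * z ^ (j + k) := by
            rw [hbj, pow_succ, pow_add]; simp only [mul_assoc]
    have stepb : ∀ g : G, (∃ i j k : ℕ, g = a ^ i * b ^ j * z ^ k) →
        ∃ i j k : ℕ, g * b = a ^ i * b ^ j * z ^ k := by
      rintro _ ⟨i, j, k, rfl⟩
      refine ⟨i, j + 1, k, ?_⟩
      rw [mul_assoc _ (z ^ k), ← hzk b, pow_succ]; simp only [mul_assoc]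
    intro g hg
    induction hg using Subgroup.closure_induction_right with
    | one => exact ⟨0, 0, 0, by simp⟩
    | mul_right g y _ hy ih =>
      rcases hy with rfl | rfl
      · exact stepa g ih
      · exact stepb g ih
    | mul_inv_cancel g y _ hy ih =>
      rcases hy with rfl | rfl
      · rw [hai]; exact stepa g ih
      · rw [hbi]; exact stepb g ih
  have hpar : ∀ (g : G), g ^ 2 = 1 → ∀ i : ℕ, g ^ i = 1 ∨ g ^ i = g := by
    intro g hg i
    rcases Nat.even_or_odd' i with ⟨m, rfl | rfl⟩
    · left; rw [pow_mul, hg, one_pow]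
    · right; rw [pow_succ, pow_mul, hg, one_pow, one_mul]
  obtain ⟨i, j, k, huf⟩ := hform u (by rw [closure_pair_top hab h]; trivial)
  have huc := Subgroup.mem_center_iff.1 hu
  have hzkc : z ^ k ∈ Subgroup.center G :=
    Subgroup.pow_mem _ (comm_mem_center hp hna hab a b) k
  have hw : u * (z ^ k)⁻¹ ∈ Subgroup.center G :=
    Subgroup.mul_mem _ hu (Subgroup.inv_mem _ hzkc)
  have hw' : u * (z ^ k)⁻¹ = a ^ i * b ^ j := by rw [huf]; simp
  rw [hw', Subgroup.mem_center_iff] at hw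
  have hone : a ^ i * b ^ j = 1 := by
    rcases hpar a ha i with h1 | h1 <;> rcases hpar b hb j with h2 | h2 <;> rw [h1, h2] at hw ⊢
    · simp
    · simp only [one_mul] at hw; exact absurd (hw a) h
    · simp only [mul_one] at hw; exact absurd (hw b).symm h
    · exact absurd (hw b).symm hab'
  rw [hone, one_mul] at huf
  apply hz1
  rw [hzu, huf, ← pow_mul, mul_comm, pow_mul, hz2, one_pow]

theorem no_GL_small (hp : IsPGroup 2 G) (hna : ¬ ∀ a b : G, a * b = b * a)
    (hab : ∀ H : Subgroup G, H ≠ ⊤ → ∀ a b : H, a * b = b * a)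
    (hnc : ∀ H : Subgroup G, H.index = 2 → ¬ IsCyclic H) {m : ℕ} (hm : m < 3)
    (ρ : G →* GL (Fin m) ℂ) (hρ : Function.Injective ρ) : False := by
  interval_cases m
  · apply hna
    intro a b
    apply hρ
    ext i
    exact i.elim0
  · apply hna
    intro a b
    apply hρ
    ext i j
    fin_cases i; fin_cases j
    simp [Matrix.mul_apply, mul_comm]
  · exact no_GL2 hp hna hab hnc (center_cyclic_of_GL2 hna ρ hρ)

/-- A subgroup with commuting elements as a commutative group. -/
abbrev commGroupOf {H : Subgroup G} (h : ∀ a b : H, a * b = b * a) : CommGroup H :=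
  { (inferInstance : Group H) with mul_comm := h }

theorem chars_of_two_gen {H : Subgroup G} (h : ∀ a b : H, a * b = b * a) (a b : G)
    (hH : H = Subgroup.closure {a, b}) :
    ∃ χ₁ χ₂ : H →* ℂˣ, (∀ x, χ₁ x = 1 → χ₂ x = 1 → x = 1) ∧ (a = b → χ₁ = χ₂) := by
  let _ : CommGroup H := commGroupOf h
  have ha : a ∈ H := by rw [hH]; exact Subgroup.subset_closure (by simp)
  have hb : b ∈ H := by rw [hH]; exact Subgroup.subset_closure (by simp)
  obtain ⟨χ₁, χ₂, h1, h2⟩ := exists_two_chars (A := H) ⟨a, ha⟩ ⟨b, hb⟩ (by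
    apply Subgroup.map_injective H.subtype_injective
    rw [MonoidHom.map_closure, Set.image_pair]
    rw [← MonoidHom.range_eq_map, Subgroup.range_subtype]
    exact hH.symm)
  exact ⟨χ₁, χ₂, h1, fun h => h2 (Subtype.ext h)⟩

theorem two_gen_of_rdim {H : Subgroup G} (h : ∀ a b : H, a * b = b * a)
    {m : ℕ} (hm : m < 3) (ρ : H →* GL (Fin m) ℂ) (hρ : Function.Injective ρ) :
    ∃ a b : G, H = Subgroup.closure {a, b} := by
  let _ : CommGroup H := commGroupOf h
  obtain ⟨χ₁, χ₂, hχ⟩ := chars_of_GL (A := H) hm ρ hρ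
  obtain ⟨a, b, hc⟩ := two_gen_of_chars χ₁ χ₂ hχ
  refine ⟨a, b, ?_⟩
  have := congrArg (Subgroup.map H.subtype) hc
  rw [MonoidHom.map_closure, Set.image_pair, ← MonoidHom.range_eq_map,
    Subgroup.range_subtype] at this
  exact this.symm

theorem rdim_le_of_le {K H : Subgroup G} (hKH : K ≤ H) (h : ∀ a b : H, a * b = b * a)
    (χ₁ χ₂ : H →* ℂˣ) (hχ : ∀ x, χ₁ x = 1 → χ₂ x = 1 → x = 1) : rdim K ≤ 2 := by
  let _ : CommGroup K := commGroupOf fun a b =>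
    Subgroup.inclusion_injective hKH (by rw [map_mul, map_mul, h])
  refine diag_rdim (A := K) (χ₁.comp (Subgroup.inclusion hKH)) (χ₂.comp (Subgroup.inclusion hKH)) ?_
  intro x h1 h2
  have := hχ _ h1 h2
  exact Subgroup.inclusion_injective hKH (this.trans (map_one _).symm)

end Lower

theorem stmt_17 (G : Type*) [Group G] [Finite G] (hp : IsPGroup 2 G)
    (hna : ¬ ∀ a b : G, a * b = b * a)
    (hab : ∀ H : Subgroup G, H ≠ ⊤ → ∀ a b : H, a * b = b * a) :
    MinFaithful G 3 ↔
      ∀ H : Subgroup G, H.index = 2 →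
        ¬ IsCyclic H ∧ ∃ a b : G, H = Subgroup.closure {a, b} := by
  constructor
  · rintro ⟨h3, hlt⟩ H hH
    have hHt := ne_top_of_index_two hH
    have hne : ∃ n, ∃ ρ : G →* GL (Fin n) ℂ, Function.Injective ρ :=
      Nat.nonempty_of_pos_sInf
        (s := {n : ℕ | ∃ ρ : G →* GL (Fin n) ℂ, Function.Injective ρ})
        (by change 0 < rdim G; omega)
    constructor
    · rintro ⟨⟨a, haH⟩, hg⟩
      have hcl : H = Subgroup.closure {a, a} := by
        rw [Set.pair_eq_singleton, ← Subgroup.zpowers_eq_closure]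
        ext x
        constructor
        · intro hx
          obtain ⟨k, hk⟩ := hg ⟨x, hx⟩
          exact ⟨k, by simpa using congrArg Subtype.val hk⟩
        · rintro ⟨k, rfl⟩
          exact H.zpow_mem haH k
      obtain ⟨χ₁, χ₂, hχ, heq⟩ := chars_of_two_gen (hab H hHt) a a hcl
      obtain rfl := heq rfl
      obtain ⟨ρ, hρ⟩ := exists_ind hH χ₁
      have : rdim G ≤ 2 := rdim_le_of_hom (by simp) ρ (by
        rw [injective_iff_map_eq_one]
        intro g hg
        obtain ⟨hgH, hg1⟩ := hρ g hg
        exact congrArg Subtype.val (hχ _ hg1 hg1))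
      omega
    · obtain ⟨n, ρ, hρ⟩ := hne
      obtain ⟨m, hm, σ, hσ⟩ := exists_hom_of_rdim_lt (G := H)
        ⟨n, ρ.comp H.subtype, hρ.comp H.subtype_injective⟩ (hlt H hHt)
      exact two_gen_of_rdim (hab H hHt) hm σ hσ
  · intro hyp
    have hchar : ∀ H : Subgroup G, H.index = 2 → ∃ χ₁ χ₂ : H →* ℂˣ,
        ∀ x, χ₁ x = 1 → χ₂ x = 1 → x = 1 := by
      intro H hH
      obtain ⟨-, a, b, hcl⟩ := hyp H hH
      obtain ⟨χ₁, χ₂, h1, -⟩ := chars_of_two_gen (hab H (ne_top_of_index_two hH)) a b hcl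
      exact ⟨χ₁, χ₂, h1⟩
    refine ⟨?_, ?_⟩
    · obtain ⟨K, hK, -⟩ := exists_index_two_mem hp hna 1
      obtain ⟨χ₁, χ₂, hχ⟩ := hchar K hK
      have hex := exists_GL3_of hp hna hab hK χ₁ χ₂ hχ
      have hle : rdim G ≤ 3 := Nat.sInf_le hex
      have hge : ¬ rdim G < 3 := by
        intro hlt
        obtain ⟨m, hm, ρ, hρ⟩ := exists_hom_of_rdim_lt ⟨3, hex⟩ hlt
        exact no_GL_small hp hna hab (fun H hH => (hyp H hH).1) hm ρ hρ
      omega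
    · intro H hH
      obtain ⟨K, hK, hle⟩ := exists_index_two_ge hp H hH
      obtain ⟨χ₁, χ₂, hχ⟩ := hchar K hK
      have := rdim_le_of_le hle (hab K (ne_top_of_index_two hK)) χ₁ χ₂ hχ
      omega
end
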